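/- arXiv:2101.05732 — 2 statements merged into one kernel-verified Lean document; each statement's English description precedes it below -/
import Mathlib

section
/- If Q is a countable thin quasi-order, then Q^{<ω}, the set of finite sequences over Q under the Higman order, is thin. -/
/-- The shift map on sequences. -/
def seqShift {Q : Type*} (X : ℕ → Q) : ℕ → Q := fun k => X (k + 1)

/-- The set `Q⃗` of sequences `X` with `¬ r (X k) (X (k+1))` for all `k`. -/
def vecSet {Q : Type*} (r : Q → Q → Prop) : Set (ℕ → Q) :=
  {X | ∀ k, ¬ r (X k) (X (k + 1))}

/-- The shift graph on a subset `A` of `Qᴺ` (with `Q` discrete, `Qᴺ` carrying the product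
Borel structure) admits a Borel proper 3-colouring. -/
def Colour3 {Q : Type*} (A : Set (ℕ → Q)) : Prop :=
  letI : MeasurableSpace Q := ⊤
  ∃ c : A → Fin 3, Measurable c ∧
    ∀ (X : ℕ → Q) (hX : X ∈ A) (hX' : seqShift X ∈ A),
      c ⟨X, hX⟩ ≠ c ⟨seqShift X, hX'⟩

/-- A relation `r` on `Q` is *thin* if the shift graph on `Q⃗ = vecSet r`
is Borel 3-colourable; otherwise it is *thick*. -/
def IsThin {Q : Type*} (r : Q → Q → Prop) : Prop := Colour3 (vecSet r)

/-- The Higman order on finite sequences over `Q`: `t₁ ≤_H t₂` iff there is a strictly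
increasing map of index sets along which the entries of `t₁` are dominated by those of `t₂`. -/
def HigmanLE {Q : Type*} (r : Q → Q → Prop) (t₁ t₂ : List Q) : Prop :=
  ∃ h : Fin t₁.length → Fin t₂.length, StrictMono h ∧ ∀ i, r (t₁.get i) (t₂.get (h i))

section Aux

theorem higmanLE_of_sublistForall₂ {Q : Type*} {r : Q → Q → Prop} {s t : List Q}
    (h : List.SublistForall₂ r s t) : HigmanLE r s t := by
  rw [List.sublistForall₂_iff] at h
  obtain ⟨l, h1, h2⟩ := h
  obtain ⟨f, hf⟩ := List.sublist_iff_exists_fin_orderEmbedding_get_eq.1 h2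
  have hl := h1.length_eq
  refine ⟨fun i => f (Fin.cast hl i), fun i j hij => f.strictMono (by simpa using hij), fun i => ?_⟩
  rw [← hf]
  exact List.Forall₂.get h1 i.2 (by rw [← hl]; exact i.2)

theorem sublistForall₂_of_higmanLE {Q : Type*} {r : Q → Q → Prop} {s t : List Q}
    (h : HigmanLE r s t) : List.SublistForall₂ r s t := by
  obtain ⟨h, hm, hr⟩ := h
  rw [List.sublistForall₂_iff]
  refine ⟨List.ofFn (fun i => t.get (h i)), ?_, ?_⟩
  · rw [List.forall₂_iff_get]
    refine ⟨by simp, fun i h1 h2 => ?_⟩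
    simpa using hr ⟨i, h1⟩
  · rw [List.sublist_iff_exists_fin_orderEmbedding_get_eq]
    refine ⟨OrderEmbedding.ofStrictMono (fun i => h (Fin.cast (by simp) i)) ?_, ?_⟩
    · intro i j hij
      exact hm (by simpa using hij)
    · intro i
      simp
      rfl

theorem higmanLE_take_mono {Q : Type*} {r : Q → Q → Prop} {s t : List Q} {m n : ℕ} (hmn : m ≤ n)
    (h : HigmanLE r s (t.take m)) : HigmanLE r s (t.take n) := by
  have := sublistForall₂_of_higmanLE h
  rw [List.sublistForall₂_iff] at this
  obtain ⟨l, h1, h2⟩ := this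
  exact higmanLE_of_sublistForall₂ (List.sublistForall₂_iff.2
    ⟨l, h1, h2.trans (List.take_sublist_take_left hmn)⟩)

theorem higmanLE_snoc {Q : Type*} {r : Q → Q → Prop} {s t : List Q} {a b : Q}
    (h : HigmanLE r s t) (hab : r a b) : HigmanLE r (s ++ [a]) (t ++ [b]) := by
  have := sublistForall₂_of_higmanLE h
  rw [List.sublistForall₂_iff] at this
  obtain ⟨l, h1, h2⟩ := this
  exact higmanLE_of_sublistForall₂ (List.sublistForall₂_iff.2
    ⟨l ++ [b], List.rel_append h1 (by simpa using hab), h2.append (List.Sublist.refl _)⟩)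

theorem higmanLE_nil {Q : Type*} {r : Q → Q → Prop} (t : List Q) : HigmanLE r [] t :=
  higmanLE_of_sublistForall₂ List.SublistForall₂.nil

theorem colour_of_recurrent {α : Type*} [MeasurableSpace α] (T : α → α) (hT : Measurable T)
    (B : Set α) (hB : MeasurableSet B)
    (h1 : ∀ x, ∃ n, T^[n] x ∈ B) (h2 : ∀ x, ∃ n, T^[n] x ∉ B) :
    ∃ c : α → Fin 3, Measurable c ∧ ∀ x, c x ≠ c (T x) := by
  classical
  let C : Set α := {x | x ∈ B ∧ T x ∉ B}
  have hC : MeasurableSet C := hB.inter (hT hB).compl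
  have hex : ∀ x, ∃ n, T^[n] x ∈ C := by
    intro x
    obtain ⟨n, hn⟩ := h1 x
    by_contra hcon
    push Not at hcon
    have key : ∀ m, T^[m] (T^[n] x) ∈ B := by
      intro m
      induction m with
      | zero => exact hn
      | succ m ih =>
        by_contra hm
        rw [Function.iterate_succ_apply'] at hm
        apply hcon (m + n)
        rw [Function.iterate_add_apply]
        exact ⟨ih, hm⟩
    obtain ⟨m, hm⟩ := h2 (T^[n] x)
    exact hm (key m)
  let F : α → ℕ := fun x => Nat.find (hex x)
  have hF : Measurable F := measurable_find hex (fun k => (hT.iterate k) hC)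
  let g : ℕ → Fin 3 := fun n => if n = 0 then 2 else if n % 2 = 0 then 0 else 1
  refine ⟨fun x => g (F x), (measurable_from_top (f := g)).comp hF, fun x => ?_⟩
  have hFx : T^[F x] x ∈ C := Nat.find_spec (hex x)
  have hFT : T^[F (T x)] (T x) ∈ C := Nat.find_spec (hex (T x))
  by_cases h0 : F x = 0
  · have : F (T x) ≠ 0 := by
      intro h
      rw [h] at hFT
      rw [h0] at hFx
      exact hFx.2 hFT.1
    simp only [g, h0, this, if_true, if_false]
    split_ifs <;> decide
  · have hs : F x = F (T x) + 1 := by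
      apply le_antisymm
      · exact Nat.find_min' (hex x) (by rw [Function.iterate_succ_apply]; exact hFT)
      · obtain ⟨m, hm⟩ := Nat.exists_eq_succ_of_ne_zero h0
        rw [hm] at hFx ⊢
        rw [Nat.succ_eq_add_one, Function.iterate_succ_apply] at hFx
        have : F (T x) ≤ m := Nat.find_min' (hex (T x)) hFx
        omega
    simp only [g, hs]
    have := Nat.mod_two_eq_zero_or_one (F (T x))
    by_cases h : F (T x) = 0
    · simp [h]
    · rcases this with h' | h'
      · have : (F (T x) + 1) % 2 = 1 := by omega
        simp [h, h', this]
      · have : (F (T x) + 1) % 2 = 0 := by omega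
        simp [h, h', this]

theorem colour_of_nonconst {α : Type*} [MeasurableSpace α] (T : α → α) (hT : Measurable T)
    (c : α → Fin 3) (hc : Measurable c)
    (h : ∀ x, ∃ n, c (T^[n] x) ≠ c (T^[n+1] x)) :
    ∃ c : α → Fin 3, Measurable c ∧ ∀ x, c x ≠ c (T x) := by
  classical
  let I : Fin 3 → Set α := fun i => {x | ∀ m, ∃ n, c (T^[n + m] x) = i}
  have hI : ∀ i, MeasurableSet (I i) := by
    intro i
    have : I i = ⋂ m, ⋃ n, (fun x => c (T^[n + m] x)) ⁻¹' {i} := by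
      ext x; simp [I]
    rw [this]
    exact MeasurableSet.iInter fun m => MeasurableSet.iUnion fun n =>
      (hc.comp (hT.iterate (n + m))) (measurableSet_singleton i)
  have hinv : ∀ i x, T x ∈ I i ↔ x ∈ I i := by
    intro i x
    constructor
    · intro hx m
      obtain ⟨n, hn⟩ := hx m
      refine ⟨n + 1, ?_⟩
      rw [show n + 1 + m = (n + m) + 1 by ring, Function.iterate_succ_apply]
      exact hn
    · intro hx m
      obtain ⟨n, hn⟩ := hx (m + 1)
      refine ⟨n, ?_⟩
      rw [← Function.iterate_succ_apply]
      exact hn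
  have hinv' : ∀ i n x, T^[n] x ∈ I i ↔ x ∈ I i := by
    intro i n
    induction n with
    | zero => intro x; rfl
    | succ n ih => intro x; rw [Function.iterate_succ_apply, ih, hinv]
  have hpig : ∀ x, x ∉ I 0 → x ∉ I 1 → x ∈ I 2 := by
    intro x h0 h1 m
    simp only [I, Set.mem_setOf_eq] at h0 h1
    push Not at h0 h1
    obtain ⟨m0, h0⟩ := h0
    obtain ⟨m1, h1⟩ := h1
    refine ⟨m0 + m1, ?_⟩
    have a0 := h0 (m1 + m)
    have a1 := h1 (m0 + m)
    rw [show m1 + m + m0 = m0 + m1 + m by ring] at a0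
    rw [show m0 + m + m1 = m0 + m1 + m by ring] at a1
    generalize c (T^[m0 + m1 + m] x) = z at *
    fin_cases z <;> simp_all
  let i : α → Fin 3 := fun x => if x ∈ I 0 then 0 else if x ∈ I 1 then 1 else 2
  have hi : Measurable i :=
    Measurable.ite (hI 0) measurable_const (Measurable.ite (hI 1) measurable_const measurable_const)
  have hiT : ∀ n x, i (T^[n] x) = i x := by
    intro n x
    simp only [i, hinv']
  have hmem : ∀ x, x ∈ I (i x) := by
    intro x
    by_cases h0 : x ∈ I 0
    · simpa [i, h0] using h0
    · by_cases h1 : x ∈ I 1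
      · simpa [i, h0, h1] using h1
      · simpa [i, h0, h1] using hpig x h0 h1
  apply colour_of_recurrent T hT {x | c x = i x} (measurableSet_eq_fun hc hi)
  · intro x
    obtain ⟨n, hn⟩ := hmem x 0
    exact ⟨n, by simpa [hiT] using hn⟩
  · intro x
    obtain ⟨n, hn⟩ := h x
    by_contra hcon
    push Not at hcon
    have a := hcon n
    have b := hcon (n + 1)
    simp only [Set.mem_setOf_eq, hiT] at a b
    exact hn (a.trans b.symm)

/-- least prefix length of `t` not embedding in the prefix of `t'` of length `l'` -/
noncomputable def hgF {Q : Type*} (r : Q → Q → Prop) (t t' : List Q) (l' : ℕ) : ℕ :=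
  sInf {l | l = t.length ∨ ¬ HigmanLE r (t.take l) (t'.take l')}

/-- finite approximations of the least valid prefix length -/
noncomputable def hgL {Q : Type*} (r : Q → Q → Prop) : ℕ → (ℕ → List Q) → ℕ
  | 0, _ => 0
  | n + 1, X => hgF r (X 0) (X 1) (hgL r n (seqShift X))

/-- the least valid prefix length -/
noncomputable def hgLim {Q : Type*} (r : Q → Q → Prop) (X : ℕ → List Q) : ℕ :=
  ⨆ n, hgL r n X

variable {Q : Type*} {r : Q → Q → Prop}

theorem hgF_le (t t' : List Q) (l' : ℕ) : hgF r t t' l' ≤ t.length :=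
  Nat.sInf_le (Or.inl rfl)

theorem hgF_spec {t t' : List Q} (h : ¬ HigmanLE r t t') (l' : ℕ) :
    ¬ HigmanLE r (t.take (hgF r t t' l')) (t'.take l') := by
  have : hgF r t t' l' ∈ {l | l = t.length ∨ ¬ HigmanLE r (t.take l) (t'.take l')} :=
    Nat.sInf_mem ⟨_, Or.inl rfl⟩
  rcases this with h' | h'
  · rw [h', List.take_length]
    intro h2
    apply h
    have := higmanLE_take_mono (n := l' + t'.length) (by omega) h2
    rwa [List.take_of_length_le (by omega)] at this
  · exact h'

theorem hgF_min {t t' : List Q} {l l' : ℕ} (h : ¬ HigmanLE r (t.take l) (t'.take l')) :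
    hgF r t t' l' ≤ l := Nat.sInf_le (Or.inr h)

theorem hgF_mono {t t' : List Q} {l l' : ℕ} (h : l ≤ l') :
    hgF r t t' l ≤ hgF r t t' l' := by
  have hm : hgF r t t' l' ∈ {l | l = t.length ∨ ¬ HigmanLE r (t.take l) (t'.take l')} :=
    Nat.sInf_mem ⟨_, Or.inl rfl⟩
  rcases hm with hm | hm
  · rw [hm]; exact hgF_le _ _ _
  · exact hgF_min fun h' => hm (higmanLE_take_mono h h')

theorem hgL_le (n : ℕ) (X : ℕ → List Q) : hgL r n X ≤ (X 0).length := by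
  cases n with
  | zero => exact Nat.zero_le _
  | succ n => exact hgF_le _ _ _

theorem hgL_succ_le (n : ℕ) : ∀ (X : ℕ → List Q), hgL r n X ≤ hgL r (n + 1) X := by
  induction n with
  | zero => intro X; exact Nat.zero_le _
  | succ n ih => intro X; exact hgF_mono (ih _)

theorem hgL_mono (X : ℕ → List Q) : Monotone (fun n => hgL r n X) :=
  monotone_nat_of_le_succ fun n => hgL_succ_le n X

theorem hgL_bdd (X : ℕ → List Q) : BddAbove (Set.range fun n => hgL r n X) :=
  ⟨(X 0).length, by rintro _ ⟨n, rfl⟩; exact hgL_le n X⟩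

theorem hgL_stab (X : ℕ → List Q) : ∃ n, ∀ m, n ≤ m → hgL r m X = hgLim r X := by
  obtain ⟨n, hn⟩ : hgLim r X ∈ Set.range (fun n => hgL r n X) :=
    Nat.sSup_mem (Set.range_nonempty _) (hgL_bdd X)
  refine ⟨n, fun m hm => le_antisymm (le_ciSup (hgL_bdd X) m) ?_⟩
  rw [← hn]
  exact hgL_mono X hm

theorem hgLim_le (X : ℕ → List Q) : hgLim r X ≤ (X 0).length := ciSup_le fun n => hgL_le n X

theorem hgLim_eq (X : ℕ → List Q) :
    hgLim r X = hgF r (X 0) (X 1) (hgLim r (seqShift X)) := by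
  obtain ⟨n, hn⟩ := hgL_stab (r := r) X
  obtain ⟨m, hm⟩ := hgL_stab (r := r) (seqShift X)
  rw [← hn (n + m + 1) (by omega), ← hm (n + m) (by omega)]
  rfl

theorem seqShift_iterate {P : Type*} (k j : ℕ) (X : ℕ → P) : (seqShift^[k] X) j = X (j + k) := by
  induction k generalizing X with
  | zero => rfl
  | succ k ih =>
    rw [Function.iterate_succ_apply, ih]
    simp only [seqShift]
    congr 1

theorem hgLim_min (X : ℕ → List Q) (l : ℕ → ℕ)
    (hl : ∀ k, ¬ HigmanLE r ((X k).take (l k)) ((X (k + 1)).take (l (k + 1)))) :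
    hgLim r X ≤ l 0 := by
  apply ciSup_le
  intro n
  induction n generalizing X l with
  | zero => exact Nat.zero_le _
  | succ n ih =>
    have := ih (seqShift X) (fun k => l (k + 1)) (fun k => hl (k + 1))
    exact (hgF_mono this).trans (hgF_min (hl 0))

theorem hgLim_not (X : ℕ → List Q) (hX : X ∈ vecSet (HigmanLE r)) :
    ¬ HigmanLE r ((X 0).take (hgLim r X)) ((X 1).take (hgLim r (seqShift X))) := by
  rw [hgLim_eq X]
  exact hgF_spec (hX 0) _

theorem hgLim_pos (X : ℕ → List Q) (hX : X ∈ vecSet (HigmanLE r)) : 0 < hgLim r X := by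
  by_contra h
  have h : hgLim r X = 0 := by omega
  apply hgLim_not X hX
  rw [h, List.take_zero]
  exact higmanLE_nil _

/-- last letter of the minimal prefix -/
noncomputable def hgA [Inhabited Q] (r : Q → Q → Prop) (X : ℕ → List Q) : Q :=
  (X 0).getD (hgLim r X - 1) default

theorem hg_take [Inhabited Q] (X : ℕ → List Q) (hX : X ∈ vecSet (HigmanLE r)) :
    (X 0).take (hgLim r X) = (X 0).take (hgLim r X - 1) ++ [hgA r X] := by
  have h1 := hgLim_pos X hX
  have h2 := hgLim_le (r := r) X
  obtain ⟨m, hm⟩ : ∃ m, hgLim r X = m + 1 := ⟨hgLim r X - 1, by omega⟩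
  simp only [hgA, hm, Nat.add_sub_cancel]
  have : m < (X 0).length := by omega
  rw [List.take_succ_eq_append_getElem this, List.getD_eq_getElem _ _ this]

theorem shift_mem {P : Type*} {s : P → P → Prop} {X : ℕ → P} (hX : X ∈ vecSet s) :
    seqShift X ∈ vecSet s := fun k => hX (k + 1)

theorem shift_mem_iter {P : Type*} {s : P → P → Prop} {X : ℕ → P} (hX : X ∈ vecSet s) (k : ℕ) :
    seqShift^[k] X ∈ vecSet s := by
  induction k with
  | zero => exact hX
  | succ k ih => rw [Function.iterate_succ_apply']; exact shift_mem ih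

theorem hg_exists [Inhabited Q] (X : ℕ → List Q) (hX : X ∈ vecSet (HigmanLE r)) :
    ∃ k, ¬ r (hgA r (seqShift^[k] X)) (hgA r (seqShift^[k + 1] X)) := by
  by_contra hcon
  push Not at hcon
  have hmin := hgLim_min (r := r) X (fun k => hgLim r (seqShift^[k] X) - 1) ?_
  · have := hgLim_pos X hX
    simp only [Function.iterate_zero, id] at hmin
    omega
  · intro k hk
    have hXk := shift_mem_iter hX k
    have hXk1 := shift_mem_iter hX (k + 1)
    have e0 := seqShift_iterate k 0 X
    have e1 := seqShift_iterate k 1 X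
    have e2 := seqShift_iterate (k + 1) 0 X
    have t1 := hg_take _ hXk
    have t2 := hg_take _ hXk1
    have key := hgLim_not _ hXk
    rw [e1, ← Function.iterate_succ_apply' seqShift] at key
    rw [e0, Nat.zero_add] at t1 key
    rw [e2, Nat.zero_add] at t2
    rw [Nat.add_comm 1 k, Nat.succ_eq_add_one, t1, t2] at key
    exact key (higmanLE_snoc hk (hcon k))

theorem measurable_hgL [Countable Q] (n : ℕ) :
    letI : MeasurableSpace (List Q) := ⊤
    Measurable (hgL r n) := by
  letI : MeasurableSpace (List Q) := ⊤
  haveI : DiscreteMeasurableSpace (List Q) := ⟨fun _ => trivial⟩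
  have hS : Measurable (seqShift : (ℕ → List Q) → (ℕ → List Q)) :=
    measurable_pi_lambda _ fun k => measurable_pi_apply (k + 1)
  show Measurable (hgL r n)
  induction n with
  | zero => exact measurable_const
  | succ n ih =>
    have h1 : Measurable (fun p : List Q × List Q × ℕ => hgF r p.1 p.2.1 p.2.2) :=
      Measurable.of_discrete
    exact h1.comp ((measurable_pi_apply 0).prodMk ((measurable_pi_apply 1).prodMk (ih.comp hS)))

theorem measurable_hgA [Countable Q] [Inhabited Q] :
    letI : MeasurableSpace (List Q) := ⊤
    letI : MeasurableSpace Q := ⊤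
    Measurable (hgA r) := by
  letI : MeasurableSpace (List Q) := ⊤
  letI : MeasurableSpace Q := ⊤
  haveI : DiscreteMeasurableSpace (List Q) := ⟨fun _ => trivial⟩
  show Measurable (hgA r)
  have hL : Measurable (hgLim r) := by
    unfold hgLim
    exact Measurable.iSup (fun n => measurable_hgL n)
  have h1 : Measurable (fun p : List Q × ℕ => p.1.getD (p.2 - 1) default) :=
    Measurable.of_discrete
  exact h1.comp ((measurable_pi_apply 0).prodMk hL)

end Aux

/-- If `Q` is a countable thin quasi-order, then `Q^{<ω}` under the Higman order is thin. -/
theorem thin_higman {Q : Type*} [Countable Q]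
    (r : Q → Q → Prop) (hr : Reflexive r) (ht : Transitive r)
    (hQ : IsThin r) : IsThin (HigmanLE r) := by
  classical
  rcases isEmpty_or_nonempty Q with hE | ⟨⟨q⟩⟩
  · have hempty : ∀ X : ℕ → List Q, X ∉ vecSet (HigmanLE r) := by
      intro X hX
      apply hX 0
      rw [Subsingleton.elim (X 0) []]
      exact higmanLE_nil _
    exact ⟨fun _ => 0, measurable_const, fun X hX => absurd hX (hempty X)⟩
  haveI : Inhabited Q := ⟨q⟩
  letI : MeasurableSpace (List Q) := ⊤
  letI : MeasurableSpace Q := ⊤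
  haveI : DiscreteMeasurableSpace Q := ⟨fun _ => trivial⟩
  obtain ⟨c, hc, hcp⟩ := hQ
  have hr2 : ∀ k : ℕ, MeasurableSet {Y : ℕ → Q | r (Y k) (Y (k + 1))} := by
    intro k
    have : Measurable (fun Y : ℕ → Q => (Y k, Y (k + 1))) :=
      (measurable_pi_apply k).prodMk (measurable_pi_apply (k + 1))
    exact this (MeasurableSet.of_discrete (s := {p : Q × Q | r p.1 p.2}))
  have hV : MeasurableSet (vecSet r) := by
    have : vecSet r = ⋂ k, {Y : ℕ → Q | r (Y k) (Y (k + 1))}ᶜ := by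
      ext Y; simp [vecSet]
    rw [this]
    exact MeasurableSet.iInter fun k => (hr2 k).compl
  let d : (ℕ → Q) → Fin 3 := fun Y =>
    if h : Y ∈ vecSet r then c ⟨Y, h⟩ else if r (Y 0) (Y 1) then 1 else 0
  have hd : Measurable d := by
    have h2 : Measurable (fun Y : ℕ → Q => if r (Y 0) (Y 1) then (1 : Fin 3) else 0) :=
      Measurable.ite (hr2 0) measurable_const measurable_const
    exact Measurable.dite (s := vecSet r) hc (h2.comp measurable_subtype_coe) hV
  let T : vecSet (HigmanLE r) → vecSet (HigmanLE r) := fun X => ⟨seqShift X.1, shift_mem X.2⟩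
  have hT : Measurable T := by
    apply Measurable.subtype_mk
    exact measurable_pi_lambda _ fun k => (measurable_pi_apply (k + 1)).comp measurable_subtype_coe
  have hTv : ∀ k X, (T^[k] X).1 = seqShift^[k] X.1 := by
    intro k
    induction k with
    | zero => intro X; rfl
    | succ k ih => intro X; rw [Function.iterate_succ_apply, Function.iterate_succ_apply, ih]
  let A : vecSet (HigmanLE r) → (ℕ → Q) := fun X k => hgA r (T^[k] X).1
  have hA : Measurable A := measurable_pi_lambda _ fun k =>
    measurable_hgA.comp (measurable_subtype_coe.comp (hT.iterate k))
  have hAT : ∀ n X k, A (T^[n] X) k = A X (k + n) := by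
    intro n X k
    simp only [A, ← Function.iterate_add_apply]
  have hAS : ∀ X, A (T X) = seqShift (A X) := fun X => rfl
  obtain ⟨c', h1, h2⟩ := colour_of_nonconst T hT (d ∘ A) (hd.comp hA) (by
    intro X
    by_cases hG : ∃ n, A (T^[n] X) ∈ vecSet r
    · obtain ⟨n, hn⟩ := hG
      refine ⟨n, ?_⟩
      rw [Function.iterate_succ_apply']
      simp only [Function.comp, hAS, d, hn, shift_mem hn, dif_pos]
      exact hcp _ _ _
    · push Not at hG
      have hval : ∀ n, (d ∘ A) (T^[n] X) = if r (A X n) (A X (n + 1)) then 1 else 0 := by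
        intro n
        simp only [Function.comp, d, hG n, dif_neg, not_false_eq_true, hAT, Nat.zero_add,
          Nat.add_comm 1 n]
      by_contra hcon
      push Not at hcon
      have hconst : ∀ n, (d ∘ A) (T^[n] X) = (d ∘ A) (T^[0] X) := by
        intro n
        induction n with
        | zero => rfl
        | succ n ih => exact (hcon n).symm.trans ih
      obtain ⟨k, hk⟩ := hg_exists X.1 X.2
      rw [← hTv, ← hTv] at hk
      have hk' : (d ∘ A) (T^[k] X) = 0 := by rw [hval]; exact if_neg hk
      apply hG 0
      intro m hm
      have hm' : (d ∘ A) (T^[m] X) = 1 := by rw [hval]; exact if_pos hm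
      rw [hconst] at hk' hm'
      rw [hk'] at hm'
      exact absurd hm' (by decide))
  exact ⟨c', h1, fun X hX hX' => h2 ⟨X, hX⟩⟩
end

section
/- Let Q be a countable thin quasi-order and κ any ordinal. Then every countable collection R of Q-labeled ordinals below κ — pairs (α, l) with α an ordinal, α < κ, and l a Q-valued function on {β : β < α} — quasi-ordered by labeled embeddability ((α₁,l₁) ≤_emb (α₂,l₂) iff there is a strictly increasing map f from {β : β < α₁} to {β : β < α₂} with l₁(β) ≤_Q l₂(f(β)) for all β < α₁), is thin. -/
set_option linter.unusedSectionVars false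
set_option linter.style.haveILetI false
namespace TLO
open Set Filter

section Dyn
variable {V : Type*} [MeasurableSpace V]

/-- discretely measurable maps: countable range, measurable fibres -/
def DM {P : Type*} (F : V → P) : Prop :=
  (range F).Countable ∧ ∀ p, MeasurableSet (F ⁻¹' {p})

theorem DM.meas {P : Type*} {F : V → P} (h : DM F) (E : Set P) : MeasurableSet (F ⁻¹' E) := by
  have : F ⁻¹' E = ⋃ p ∈ range F ∩ E, F ⁻¹' {p} := by
    ext x; simp
  rw [this]
  exact MeasurableSet.biUnion (h.1.mono inter_subset_left) fun p _ => h.2 p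

theorem DM.comp {P P' : Type*} {F : V → P} (h : DM F) (g : P → P') : DM (fun x => g (F x)) := by
  refine ⟨?_, fun p => ?_⟩
  · have : range (fun x => g (F x)) = g '' range F := range_comp g F
    rw [this]; exact h.1.image g
  · exact h.meas (g ⁻¹' {p})

theorem DM.prod {P P' : Type*} {F : V → P} {G : V → P'} (h : DM F) (h' : DM G) :
    DM (fun x => (F x, G x)) := by
  refine ⟨?_, fun p => ?_⟩
  · refine (h.1.prod h'.1).mono ?_
    rintro _ ⟨x, rfl⟩
    exact ⟨⟨x, rfl⟩, ⟨x, rfl⟩⟩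
  · have : (fun x => (F x, G x)) ⁻¹' {p} = F ⁻¹' {p.1} ∩ G ⁻¹' {p.2} := by
      ext x; simp [Prod.ext_iff]
    rw [this]; exact (h.2 _).inter (h'.2 _)

theorem DM.shift {P : Type*} {F : V → P} (h : DM F) {S : V → V} (hS : Measurable S) :
    DM (fun x => F (S x)) := by
  refine ⟨h.1.mono ?_, fun p => hS (h.2 p)⟩
  rintro _ ⟨x, rfl⟩; exact ⟨_, rfl⟩

theorem DM.select {P : Type*} {F : ℕ → V → P} (h : ∀ n, DM (F n)) {N : V → ℕ} (hN : DM N) :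
    DM (fun x => F (N x) x) := by
  refine ⟨(countable_iUnion fun n => (h n).1).mono ?_, fun p => ?_⟩
  · rintro _ ⟨x, rfl⟩; exact mem_iUnion.2 ⟨N x, x, rfl⟩
  · have : (fun x => F (N x) x) ⁻¹' {p} = ⋃ n, (N ⁻¹' {n} ∩ F n ⁻¹' {p}) := by
      ext x; simp
    rw [this]
    exact MeasurableSet.iUnion fun n => (hN.2 n).inter ((h n).2 p)

theorem DM.natInf {p : ℕ → V → Prop} (h : ∀ n, MeasurableSet {x | p n x}) :
    DM (fun x => sInf {n | p n x}) := by
  refine ⟨to_countable _, fun m => ?_⟩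
  have : (fun x => sInf {n | p n x}) ⁻¹' {m} =
      ({x | p m x} ∩ ⋂ k ∈ {k | k < m}, {x | p k x}ᶜ) ∪
        ((⋂ k, {x | p k x}ᶜ) ∩ {_x | m = 0}) := by
    ext x
    simp only [mem_preimage, mem_singleton_iff, mem_union, mem_inter_iff, mem_ofPred_eq, mem_iInter,
      mem_compl_iff]
    constructor
    · rintro rfl
      by_cases hne : {n | p n x}.Nonempty
      · exact Or.inl ⟨Nat.sInf_mem hne, fun k hk => Nat.notMem_of_lt_sInf hk⟩
      · right
        rw [not_nonempty_iff_eq_empty] at hne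
        refine ⟨fun k hk => ?_, ?_⟩
        · have : k ∈ {n | p n x} := hk
          rw [hne] at this; exact this
        · rw [hne]; simp
    · rintro (⟨h1, h2⟩ | ⟨h1, h2⟩)
      · apply le_antisymm
        · exact Nat.sInf_le h1
        · by_contra hlt
          push Not at hlt
          exact h2 _ hlt (Nat.sInf_mem (s := {n | p n x}) ⟨m, h1⟩)
      · have : {n | p n x} = ∅ := by
          ext n; simpa using h1 n
        rw [this, h2]; simp
  rw [this]
  refine MeasurableSet.union (MeasurableSet.inter (h m) ?_) (MeasurableSet.inter ?_ ?_)
  · exact MeasurableSet.biInter (to_countable _) fun k _ => (h k).compl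
  · exact MeasurableSet.iInter fun k => (h k).compl
  · exact MeasurableSet.const _

/-- The orbit of `x` visits both `A` and its complement infinitely often. -/
def SplitAt (S : V → V) (A : Set V) (x : V) : Prop :=
  (∃ᶠ k in atTop, S^[k] x ∈ A) ∧ (∃ᶠ k in atTop, S^[k] x ∉ A)

/-- eventually bad orbits are split by a countable measurable family -/
def Good (S : V → V) {P : Type*} (ρ : P → P → Prop) : Prop :=
  ∀ F : V → P, DM F → ∃ A : ℕ → Set V, (∀ i, MeasurableSet (A i)) ∧
    ∀ x, (∀ᶠ k in atTop, ¬ ρ (F (S^[k] x)) (F (S^[k + 1] x))) → ∃ i, SplitAt S (A i) x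

theorem freq_shift {p : ℕ → Prop} : (∃ᶠ k in atTop, p (k + 1)) ↔ ∃ᶠ k in atTop, p k := by
  simp only [frequently_atTop]
  constructor
  · intro h a
    obtain ⟨b, hb, hp⟩ := h a
    exact ⟨b + 1, by omega, hp⟩
  · intro h a
    obtain ⟨b, hb, hp⟩ := h (a + 1)
    obtain ⟨c, rfl⟩ : ∃ c, b = c + 1 := ⟨b - 1, by omega⟩
    exact ⟨c, by omega, hp⟩

theorem splitAt_shift {S : V → V} {A : Set V} {x : V} : SplitAt S A (S x) ↔ SplitAt S A x := by
  unfold SplitAt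
  simp only [← Function.iterate_succ_apply]
  rw [freq_shift (p := fun k => S^[k] x ∈ A), freq_shift (p := fun k => S^[k] x ∉ A)]

theorem meas_freq {S : V → V} (hS : Measurable S) {A : Set V} (hA : MeasurableSet A) :
    MeasurableSet {x | ∃ᶠ k in atTop, S^[k] x ∈ A} := by
  have : {x | ∃ᶠ k in atTop, S^[k] x ∈ A} = ⋂ a : ℕ, ⋃ b ∈ {b | a ≤ b}, S^[b] ⁻¹' A := by
    ext x; simp [frequently_atTop]
  rw [this]
  exact MeasurableSet.iInter fun a => MeasurableSet.biUnion (to_countable _)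
    fun b _ => (hS.iterate b) hA

theorem colour_of_split {S : V → V} (hS : Measurable S) (A : ℕ → Set V)
    (hA : ∀ i, MeasurableSet (A i)) (h : ∀ x, ∃ i, SplitAt S (A i) x) :
    ∃ c : V → Fin 3, Measurable c ∧ ∀ x, c x ≠ c (S x) := by
  set idx : V → ℕ := fun x => sInf {i | SplitAt S (A i) x} with hidx
  have hidxS : ∀ x, idx (S x) = idx x := by
    intro x; simp only [hidx, splitAt_shift]
  have hidxk : ∀ k x, idx (S^[k] x) = idx x := by
    intro k; induction k with
    | zero => intro x; rfl
    | succ k ih => intro x; rw [Function.iterate_succ_apply, ih, hidxS]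
  have hspec : ∀ x, SplitAt S (A (idx x)) x := fun x =>
    Nat.sInf_mem (s := {i | SplitAt S (A i) x}) (h x)
  have hidxM : DM idx := DM.natInf fun i =>
    (meas_freq hS (hA i)).inter (meas_freq hS (hA i).compl)
  set B : Set V := ⋃ i, (idx ⁻¹' {i} ∩ A i) with hB
  have hBmem : ∀ x, x ∈ B ↔ x ∈ A (idx x) := by intro x; simp [hB]
  have hBm : MeasurableSet B := MeasurableSet.iUnion fun i => (hidxM.2 i).inter (hA i)
  set E : Set V := B ∩ S ⁻¹' Bᶜ with hE
  have hEm : MeasurableSet E := hBm.inter (hS hBm.compl)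
  have hEind : ∀ x, x ∈ E → S x ∉ E := fun x hx hx' => hx.2 hx'.1
  have hErec : ∀ x, ∃ n, S^[n] x ∈ E := by
    intro x
    by_contra hcon
    push Not at hcon
    obtain ⟨h1, h2⟩ := hspec x
    obtain ⟨n, hn⟩ := h1.exists
    have hall : ∀ m, n ≤ m → S^[m] x ∈ B := by
      intro m hm
      induction m, hm using Nat.le_induction with
      | base => rw [hBmem, hidxk]; exact hn
      | succ m hm ih =>
        by_contra hnot
        refine hcon m ⟨ih, ?_⟩
        rw [Function.iterate_succ_apply'] at hnot
        exact hnot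
    obtain ⟨m, hm, hm'⟩ := (frequently_atTop.1 h2) n
    have := hall m hm
    rw [hBmem, hidxk] at this
    exact hm' this
  set D : V → ℕ := fun x => sInf {n | S^[n] x ∈ E} with hD
  have hDM : DM D := DM.natInf fun n => (hS.iterate n) hEm
  have hDmem : ∀ x, S^[D x] x ∈ E := fun x => Nat.sInf_mem (s := {n | S^[n] x ∈ E}) (hErec x)
  have hD0 : ∀ x, D x = 0 → D (S x) ≠ 0 := by
    intro x h0 h1
    have e0 := hDmem x
    have e1 := hDmem (S x)
    rw [h0] at e0; rw [h1] at e1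
    exact hEind x e0 e1
  have hDs : ∀ x, D x ≠ 0 → D x = D (S x) + 1 := by
    intro x h0
    apply le_antisymm
    · apply Nat.sInf_le
      change S^[D (S x) + 1] x ∈ E
      rw [Function.iterate_succ_apply]; exact hDmem _
    · obtain ⟨m, hm⟩ := Nat.exists_eq_succ_of_ne_zero h0
      have := hDmem x
      rw [hm, Nat.succ_eq_add_one, Function.iterate_succ_apply] at this
      have : D (S x) ≤ m := Nat.sInf_le this
      omega
  set col : ℕ → Fin 3 := fun n => if n = 0 then 0 else if n % 2 = 0 then 1 else 2 with hcol
  refine ⟨fun x => col (D x), ?_, ?_⟩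
  · intro s _
    exact (hDM.comp col).meas s
  · intro x
    have aux : ∀ n : ℕ, col (n + 1) ≠ col n := by
      intro n
      rcases Nat.eq_zero_or_pos n with rfl | hn
      · decide
      · have h1 : n ≠ 0 := by omega
        rcases Nat.mod_two_eq_zero_or_one n with h | h
        · have h2 : (n + 1) % 2 = 1 := by omega
          simp [hcol, h1, h, h2]
        · have h2 : (n + 1) % 2 = 0 := by omega
          simp [hcol, h1, h, h2]
    have aux0 : ∀ n : ℕ, n ≠ 0 → col 0 ≠ col n := by
      intro n hn
      simp only [hcol, hn, if_true, if_false]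
      split_ifs <;> decide
    change col (D x) ≠ col (D (S x))
    by_cases h0 : D x = 0
    · rw [h0]; exact aux0 _ (hD0 x h0)
    · rw [hDs x h0]; exact aux _

theorem DM.iter {P : Type*} {F : V → P} (h : DM F) {S : V → V} (hS : Measurable S) (k : ℕ) :
    DM (fun x => F (S^[k] x)) := h.shift (hS.iterate k)

theorem good_of_thin {S : V → V} (hS : Measurable S) {Q : Type*} {r : Q → Q → Prop}
    (hQ : IsThin r) : Good S r := by
  intro F hF
  letI : MeasurableSpace Q := ⊤
  obtain ⟨c, hc, hcol⟩ := hQ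
  set Φ : V → ℕ → Q := fun x k => F (S^[k] x) with hΦ
  have hΦm : Measurable Φ := by
    rw [measurable_pi_iff]
    intro k s _
    exact (hF.iter hS k).meas s
  have hvm : MeasurableSet (Φ ⁻¹' vecSet r) := by
    have : Φ ⁻¹' vecSet r =
        ⋂ k, (fun x => (F (S^[k] x), F (S^[k + 1] x))) ⁻¹' {p | ¬ r p.1 p.2} := by
      ext x; simp [vecSet, hΦ]
    rw [this]
    exact MeasurableSet.iInter fun k => ((hF.iter hS k).prod (hF.iter hS (k + 1))).meas _
  have hB : ∀ i : Fin 3, ∃ B : Set (ℕ → Q), MeasurableSet B ∧ Subtype.val ⁻¹' B = c ⁻¹' {i} :=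
    fun i => hc (measurableSet_singleton i)
  choose B hBm hBc using hB
  have hBmem : ∀ (i : Fin 3) (X : ℕ → Q) (hX : X ∈ vecSet r), X ∈ B i ↔ c ⟨X, hX⟩ = i := by
    intro i X hX
    have : (⟨X, hX⟩ : vecSet r) ∈ Subtype.val ⁻¹' B i ↔ (⟨X, hX⟩ : vecSet r) ∈ c ⁻¹' {i} := by
      rw [hBc]
    simpa using this
  refine ⟨fun n => Φ ⁻¹' vecSet r ∩ Φ ⁻¹' (B (Fin.ofNat 3 n)),
    fun n => hvm.inter (hΦm (hBm _)), ?_⟩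
  intro x hx
  obtain ⟨K, hK⟩ := eventually_atTop.1 hx
  have hv : ∀ k, K ≤ k → Φ (S^[k] x) ∈ vecSet r := by
    intro k hk j
    have := hK (j + k) (by omega)
    simp only [hΦ, ← Function.iterate_add_apply]
    convert this using 3
    rw [show j + 1 + k = j + k + 1 by omega]
  have hsh : ∀ y, Φ (S y) = seqShift (Φ y) := by
    intro y; funext k; simp [hΦ, seqShift, Function.iterate_succ_apply]
  have hne : ∀ (k) (i : Fin 3), K ≤ k → Φ (S^[k] x) ∈ B i → Φ (S^[k + 1] x) ∉ B i := by
    intro k i hk h1 h2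
    have hv1 := hv k hk
    have hv2 := hv (k + 1) (by omega)
    rw [hBmem i _ hv1] at h1
    rw [hBmem i _ hv2] at h2
    have e : Φ (S^[k + 1] x) = seqShift (Φ (S^[k] x)) := by
      rw [Function.iterate_succ_apply', hsh]
    have hv3 := hv2
    rw [e] at hv3
    refine hcol _ hv1 hv3 ?_
    rw [h1, ← h2]
    congr 1
    exact Subtype.ext e
  have hex : ∃ i : Fin 3, ∃ᶠ k in atTop, Φ (S^[k] x) ∈ B i := by
    by_contra hcon
    push Not at hcon
    have h2 : ∀ᶠ k in atTop, ∀ i : Fin 3, Φ (S^[k] x) ∉ B i :=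
      eventually_all.2 fun i => by simpa [not_frequently] using hcon i
    obtain ⟨k, h2, hk⟩ := (h2.and (eventually_ge_atTop K)).exists
    exact h2 (c ⟨_, hv k hk⟩) ((hBmem _ _ (hv k hk)).2 rfl)
  obtain ⟨i, hi⟩ := hex
  refine ⟨i.val, ?_⟩
  have hi3 : Fin.ofNat 3 i.val = i := by ext; simp [Fin.ofNat]
  simp only [hi3]
  constructor
  · refine (hi.and_eventually (eventually_ge_atTop K)).mono ?_
    rintro k ⟨h1, h2⟩
    exact ⟨hv k h2, h1⟩
  · rw [← freq_shift]
    refine (hi.and_eventually (eventually_ge_atTop K)).mono ?_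
    rintro k ⟨h1, h2⟩ h3
    exact hne k i h2 h1 h3.2

/-- relation on labels with an additional incomparable mark -/
def optRel {Q : Type*} (r : Q → Q → Prop) : Option Q → Option Q → Prop
  | none, none => True
  | some a, some b => r a b
  | _, _ => False

theorem good_opt {S : V → V} {Q : Type*} [Nonempty Q] {r : Q → Q → Prop}
    (hQ : Good S r) : Good S (optRel r) := by
  intro F hF
  obtain ⟨q0⟩ := ‹Nonempty Q›
  obtain ⟨A, hA, hA'⟩ := hQ (fun x => (F x).getD q0) (hF.comp fun o => o.getD q0)
  refine ⟨fun n => match n with | 0 => F ⁻¹' {none} | n + 1 => A n, ?_, ?_⟩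
  · rintro (_ | n)
    · exact hF.meas _
    · exact hA n
  · intro x hx
    by_cases hf : ∃ᶠ k in atTop, F (S^[k] x) = none
    · refine ⟨0, hf, ?_⟩
      rw [← freq_shift]
      refine (hf.and_eventually hx).mono ?_
      rintro k ⟨h1, h2⟩ h3
      have h3' : F (S^[k + 1] x) = none := h3
      rw [h1, h3'] at h2
      exact h2 trivial
    · rw [not_frequently] at hf
      obtain ⟨i, hi⟩ := hA' x (by
        obtain ⟨K, hK⟩ := eventually_atTop.1 (hf.and hx)
        refine eventually_atTop.2 ⟨K, fun k hk => ?_⟩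
        obtain ⟨h1, h2⟩ := hK k hk
        obtain ⟨h3, -⟩ := hK (k + 1) (by omega)
        obtain ⟨a, ha⟩ := Option.ne_none_iff_exists'.1 h1
        obtain ⟨b, hb⟩ := Option.ne_none_iff_exists'.1 h3
        rw [ha, hb] at h2 ⊢
        exact h2)
      exact ⟨i + 1, hi⟩

/-- The descent lemma. -/
theorem good_descent {S : V → V} (hS : Measurable S) {Q P : Type*} {r : Q → Q → Prop}
    {ρ : P → P → Prop}
    (el : P → Set P) (isLeaf : P → Prop) (lab : P → Q) {O : Type*} [LinearOrder O]
    [WellFoundedLT O] (rk : P → O)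
    (step : ∀ x y, ¬ ρ x y → ∃ x' ∈ el x, ∀ y' ∈ el y, ¬ ρ x' y')
    (hleaf : ∀ x, isLeaf x → ∀ x' ∈ el x, x' = x)
    (hnleaf : ∀ x, ¬ isLeaf x → ∀ x' ∈ el x, rk x' < rk x)
    (hlab : ∀ x y, isLeaf x → isLeaf y → ¬ ρ x y → ¬ r (lab x) (lab y))
    (hQ : Good S r) : Good S ρ := by
  classical
  have hd : ∃ d : P × P → P, ∀ x y, ¬ ρ x y → d (x, y) ∈ el x ∧ ∀ y' ∈ el y, ¬ ρ (d (x, y)) y' := by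
    refine ⟨fun p => if h : ¬ ρ p.1 p.2 then (step _ _ h).choose else p.1, fun x y h => ?_⟩
    simp only [h, not_false_eq_true, dif_pos]
    exact (step _ _ h).choose_spec
  obtain ⟨d, hd⟩ := hd
  intro F hF
  let G : ℕ → V → P := fun n => Nat.rec F (fun _ g x => d (g x, g (S x))) n
  have hG0 : G 0 = F := rfl
  have hGs : ∀ n x, G (n + 1) x = d (G n x, G n (S x)) := fun n x => rfl
  have hGm : ∀ n, DM (G n) := by
    intro n; induction n with
    | zero => exact hF
    | succ n ih => exact (ih.prod (ih.shift hS)).comp d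
  set N : V → ℕ := fun x => sInf {n | isLeaf (G n x)} with hN
  have hNm : DM N := DM.natInf fun n => (hGm n).meas {p | isLeaf p}
  obtain ⟨A, hA, hA'⟩ := hQ (fun x => lab (G (N x) x)) ((DM.select hGm hNm).comp lab)
  refine ⟨A, hA, fun x hx => hA' x ?_⟩
  obtain ⟨K, hK⟩ := eventually_atTop.1 hx
  -- bad at all stages
  have hbad : ∀ n k, K ≤ k → ¬ ρ (G n (S^[k] x)) (G n (S^[k + 1] x)) := by
    intro n; induction n with
    | zero => exact hK
    | succ n ih =>
      intro k hk
      rw [hGs, hGs]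
      simp only [← Function.iterate_succ_apply' S]
      exact (hd _ _ (ih k hk)).2 _ (hd _ _ (ih (k + 1) (by omega))).1
  have hmem : ∀ n k, K ≤ k → G (n + 1) (S^[k] x) ∈ el (G n (S^[k] x)) := by
    intro n k hk
    rw [hGs, ← Function.iterate_succ_apply' S]
    exact (hd _ _ (hbad n k hk)).1
  have hex : ∀ k, K ≤ k → ∃ n, isLeaf (G n (S^[k] x)) := by
    intro k hk
    by_contra hcon
    push Not at hcon
    have hdec : ∀ n, rk (G (n + 1) (S^[k] x)) < rk (G n (S^[k] x)) :=
      fun n => hnleaf _ (hcon n) _ (hmem n k hk)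
    have := RelEmbedding.natGT (r := ((· < ·) : O → O → Prop)) (fun n => rk (G n (S^[k] x))) hdec
    exact (RelEmbedding.wellFounded_iff_isEmpty.1 wellFounded_lt).false this
  have hstab : ∀ k, K ≤ k → ∀ m, N (S^[k] x) ≤ m →
      G m (S^[k] x) = G (N (S^[k] x)) (S^[k] x) := by
    intro k hk m hm
    have hl : isLeaf (G (N (S^[k] x)) (S^[k] x)) :=
      Nat.sInf_mem (s := {n | isLeaf (G n (S^[k] x))}) (hex k hk)
    induction m, hm using Nat.le_induction with
    | base => rfl
    | succ m hm ih =>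
      have := hmem m k hk
      rw [ih] at this
      exact hleaf _ hl _ this
  refine eventually_atTop.2 ⟨K, fun k hk => ?_⟩
  have l1 : isLeaf (G (N (S^[k] x)) (S^[k] x)) :=
    Nat.sInf_mem (s := {n | isLeaf (G n (S^[k] x))}) (hex k hk)
  have l2 : isLeaf (G (N (S^[k + 1] x)) (S^[k + 1] x)) :=
    Nat.sInf_mem (s := {n | isLeaf (G n (S^[k + 1] x))}) (hex (k + 1) (by omega))
  refine hlab _ _ l1 l2 ?_
  have := hbad (max (N (S^[k] x)) (N (S^[k + 1] x))) k hk
  rwa [hstab k hk _ (le_max_left _ _), hstab (k + 1) (by omega) _ (le_max_right _ _)] at this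

end Dyn
end TLO
namespace TLO
open Set Filter
section Lists
variable {V : Type*} [MeasurableSpace V]

theorem slf_left {P : Type*} {ρ : P → P → Prop} {u u' v : List P} (h : u.Sublist u')
    (h' : List.SublistForall₂ ρ u' v) : List.SublistForall₂ ρ u v := by
  induction h' generalizing u with
  | nil => rw [List.sublist_nil.1 h]; exact .nil
  | cons hr _ ih =>
    cases h with
    | cons _ h => exact .cons_right (ih h)
    | cons_cons _ h => exact .cons hr (ih h)
  | cons_right _ ih => exact .cons_right (ih h)

theorem slf_right {P : Type*} {ρ : P → P → Prop} {u v v' : List P} (h : v.Sublist v')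
    (h' : List.SublistForall₂ ρ u v) : List.SublistForall₂ ρ u v' := by
  rw [List.sublistForall₂_iff] at h' ⊢
  obtain ⟨l, h1, h2⟩ := h'
  exact ⟨l, h1, h2.trans h⟩

theorem slf_snoc {P : Type*} {ρ : P → P → Prop} {u v : List P} {a b : P}
    (h : List.SublistForall₂ ρ u v) (hab : ρ a b) :
    List.SublistForall₂ ρ (u ++ [a]) (v ++ [b]) := by
  rw [List.sublistForall₂_iff] at h ⊢
  obtain ⟨l, h1, h2⟩ := h
  exact ⟨l ++ [b], List.rel_append h1 (.cons hab .nil), h2.append (List.Sublist.refl _)⟩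

/-- finite-stage winning positions -/
def wn (S : V → V) {P : Type*} (ρ : P → P → Prop) (F : V → List P) : ℕ → ℕ → V → Prop
  | 0, _, _ => True
  | j + 1, n, x => ∃ m, m ≤ (F (S x)).length ∧
      ¬ List.SublistForall₂ ρ ((F x).take n) ((F (S x)).take m) ∧ wn S ρ F j m (S x)

theorem wn_anti (S : V → V) {P : Type*} (ρ : P → P → Prop) (F : V → List P) (j : ℕ) :
    ∀ n x, wn S ρ F (j + 1) n x → wn S ρ F j n x := by
  induction j with
  | zero => intro n x _; trivial
  | succ j ih =>
    rintro n x ⟨m, h1, h2, h3⟩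
    exact ⟨m, h1, h2, ih _ _ h3⟩

theorem wn_anti' (S : V → V) {P : Type*} (ρ : P → P → Prop) (F : V → List P) {i j : ℕ}
    (hij : i ≤ j) (n x) (h : wn S ρ F j n x) : wn S ρ F i n x := by
  induction j, hij using Nat.le_induction with
  | base => exact h
  | succ j _ ih => exact ih (wn_anti S ρ F j n x h)

theorem wn_meas {S : V → V} (hS : Measurable S) {P : Type*} (ρ : P → P → Prop) {F : V → List P}
    (hF : DM F) (j : ℕ) : ∀ n, MeasurableSet {x | wn S ρ F j n x} := by
  induction j with
  | zero => intro n; simp [wn]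
  | succ j ih =>
    intro n
    have : {x | wn S ρ F (j + 1) n x} = ⋃ m, ((fun x => (F x, F (S x))) ⁻¹'
        {p | m ≤ p.2.length ∧ ¬ List.SublistForall₂ ρ (p.1.take n) (p.2.take m)} ∩
          S ⁻¹' {x | wn S ρ F j m x}) := by
      ext x; simp [wn, and_assoc]
    rw [this]
    exact MeasurableSet.iUnion fun m => ((hF.prod (hF.shift hS)).meas _).inter (hS (ih m))

theorem win_step {S : V → V} {P : Type*} {ρ : P → P → Prop} {F : V → List P} {n : ℕ} {x : V}
    (h : ∀ j, wn S ρ F j n x) : ∃ m, m ≤ (F (S x)).length ∧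
      ¬ List.SublistForall₂ ρ ((F x).take n) ((F (S x)).take m) ∧ ∀ j, wn S ρ F j m (S x) := by
  have h' : ∀ j, ∃ m : Fin ((F (S x)).length + 1),
      ¬ List.SublistForall₂ ρ ((F x).take n) ((F (S x)).take m) ∧ wn S ρ F j m (S x) := by
    intro j
    obtain ⟨m, h1, h2, h3⟩ := h (j + 1)
    exact ⟨⟨m, by omega⟩, h2, h3⟩
  choose m hm1 hm2 using h'
  obtain ⟨m0, hm0⟩ := Finite.exists_infinite_fiber m
  rw [Set.infinite_coe_iff] at hm0
  refine ⟨m0, by omega, ?_, ?_⟩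
  · obtain ⟨j, hj⟩ := hm0.nonempty
    have : m j = m0 := hj
    rw [← this]; exact hm1 j
  · intro j
    obtain ⟨i, hi, hij⟩ := hm0.exists_gt j
    have : m i = m0 := hi
    rw [← this]
    exact wn_anti' S ρ F hij.le _ _ (hm2 i)

theorem good_list {S : V → V} (hS : Measurable S) {P : Type*} [Nonempty P] {ρ : P → P → Prop}
    (hP : Good S ρ) : Good S (List.SublistForall₂ ρ) := by
  intro F hF
  obtain ⟨p0⟩ := ‹Nonempty P›
  set N : V → ℕ := fun x => sInf {n | ∀ j, wn S ρ F j n x} with hN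
  have hNm : DM N := DM.natInf fun n => by
    have : {x | ∀ j, wn S ρ F j n x} = ⋂ j, {x | wn S ρ F j n x} := by ext x; simp
    rw [this]; exact MeasurableSet.iInter fun j => wn_meas hS ρ hF j n
  set T : Set V := {x | ¬ List.SublistForall₂ ρ ((F x).take (N x - 1))
    ((F (S x)).take (N (S x) - 1))} with hT
  have hTm : MeasurableSet T :=
    ((hF.prod hNm).prod ((hF.prod hNm).shift hS)).meas
      {p | ¬ List.SublistForall₂ ρ (p.1.1.take (p.1.2 - 1)) (p.2.1.take (p.2.2 - 1))}
  obtain ⟨A, hA, hA'⟩ := hP (fun x => (F x).getD (N x - 1) p0)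
    ((hF.prod hNm).comp fun p => p.1.getD (p.2 - 1) p0)
  refine ⟨fun n => match n with | 0 => T | n + 1 => A n, ?_, ?_⟩
  · rintro (_ | n)
    · exact hTm
    · exact hA n
  intro x hx
  obtain ⟨K, hK⟩ := eventually_atTop.1 hx
  have hK' : ∀ k, K ≤ k → ¬ List.SublistForall₂ ρ (F (S^[k] x)) (F (S (S^[k] x))) := by
    intro k hk
    rw [← Function.iterate_succ_apply' S]; exact hK k hk
  have hfull : ∀ j k, K ≤ k → wn S ρ F j (F (S^[k] x)).length (S^[k] x) := by
    intro j; induction j with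
    | zero => intro k _; trivial
    | succ j ih =>
      intro k hk
      refine ⟨_, le_rfl, ?_, ?_⟩
      · rw [List.take_length, List.take_length]; exact hK' k hk
      · have := ih (k + 1) (by omega)
        rwa [Function.iterate_succ_apply'] at this
  have hwin : ∀ k, K ≤ k → ∀ j, wn S ρ F j (N (S^[k] x)) (S^[k] x) := fun k hk =>
    Nat.sInf_mem (s := {n | ∀ j, wn S ρ F j n (S^[k] x)}) ⟨_, fun j => hfull j k hk⟩
  have hle : ∀ k, K ≤ k → N (S^[k] x) ≤ (F (S^[k] x)).length := fun k hk =>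
    Nat.sInf_le (s := {n | ∀ j, wn S ρ F j n (S^[k] x)}) fun j => hfull j k hk
  have hpos : ∀ k, K ≤ k → 1 ≤ N (S^[k] x) := by
    intro k hk
    by_contra h0
    obtain ⟨m, -, h2, -⟩ := win_step (hwin k hk)
    have : N (S^[k] x) = 0 := by omega
    rw [this] at h2
    exact h2 .nil
  have hlose : ∀ k, K ≤ k → ¬ ∀ j, wn S ρ F j (N (S^[k] x) - 1) (S^[k] x) := by
    intro k hk h
    have h1 : N (S^[k] x) ≤ N (S^[k] x) - 1 :=
      Nat.sInf_le (s := {n | ∀ j, wn S ρ F j n (S^[k] x)}) h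
    have := hpos k hk
    omega
  have hbad : ∀ k, K ≤ k → ¬ List.SublistForall₂ ρ ((F (S^[k] x)).take (N (S^[k] x)))
      ((F (S^[k + 1] x)).take (N (S^[k + 1] x))) := by
    intro k hk h
    obtain ⟨m, -, h2, h3⟩ := win_step (hwin k hk)
    rw [← Function.iterate_succ_apply' S] at h2 h3
    have hm : N (S^[k + 1] x) ≤ m :=
      Nat.sInf_le (s := {n | ∀ j, wn S ρ F j n (S^[k + 1] x)}) h3
    exact h2 (slf_right (List.take_sublist_take_left hm) h)
  have hnT : ∃ᶠ k in atTop, S^[k] x ∉ T := by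
    intro hev
    simp only [not_not] at hev
    obtain ⟨K', hK'⟩ := eventually_atTop.1 hev
    have : ∀ j k, max K K' ≤ k → wn S ρ F j (N (S^[k] x) - 1) (S^[k] x) := by
      intro j; induction j with
      | zero => intro k _; trivial
      | succ j ih =>
        intro k hk
        refine ⟨N (S^[k + 1] x) - 1, ?_, ?_, ?_⟩
        · have := hle (k + 1) (by omega)
          rw [← Function.iterate_succ_apply' S]
          change N (S^[k + 1] x) - 1 ≤ (F (S^[k + 1] x)).length
          omega
        · have := hK' k (by omega)
          simp only [hT, mem_ofPred_eq, ← Function.iterate_succ_apply' S] at this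
          rw [← Function.iterate_succ_apply' S]
          exact this
        · rw [← Function.iterate_succ_apply' S]
          exact ih (k + 1) (by omega)
    exact hlose (max K K') (le_max_left _ _) fun j => this j _ le_rfl
  by_cases hfT : ∃ᶠ k in atTop, S^[k] x ∈ T
  · exact ⟨0, hfT, hnT⟩
  rw [not_frequently] at hfT
  obtain ⟨i, hi⟩ := hA' x (by
    refine (hfT.and (eventually_ge_atTop K)).mono ?_
    rintro k ⟨h1, hk⟩ hρ
    simp only [hT, mem_ofPred_eq, not_not, ← Function.iterate_succ_apply' S] at h1
    refine hbad k hk ?_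
    have key : ∀ k, K ≤ k → (F (S^[k] x)).take (N (S^[k] x)) =
        (F (S^[k] x)).take (N (S^[k] x) - 1) ++ [(F (S^[k] x)).getD (N (S^[k] x) - 1) p0] := by
      intro k hk
      have a1 := hpos k hk
      have a2 := hle k hk
      obtain ⟨n, hn⟩ : ∃ n, N (S^[k] x) = n + 1 := ⟨N (S^[k] x) - 1, by omega⟩
      rw [hn] at a2 ⊢
      rw [Nat.add_sub_cancel, List.take_add_one, List.getD_eq_getElem?_getD]
      rw [List.getElem?_eq_getElem (by omega)]
      rfl
    rw [key k hk, key (k + 1) (by omega)]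
    exact slf_snoc h1 hρ)
  exact ⟨i + 1, hi⟩

end Lists
end TLO
namespace TLO
open Set Filter
section Ramsey

/-- the first `k` values -/
def pre (x : ℕ → ℕ) (k : ℕ) : List ℕ := (List.range k).map x

/-- prepend a finite sequence -/
def app : List ℕ → (ℕ → ℕ) → (ℕ → ℕ)
  | [], x => x
  | a :: t, x => fun n => Nat.casesOn n a (app t x)

theorem app_append (t u : List ℕ) (x : ℕ → ℕ) : app (t ++ u) x = app t (app u x) := by
  induction t with
  | nil => rfl
  | cons a t ih => simp only [List.cons_append, app, ih]

theorem pre_succ (x : ℕ → ℕ) (k : ℕ) : pre x (k + 1) = pre x k ++ [x k] := by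
  simp [pre, List.range_succ]

theorem pre_succ' (x : ℕ → ℕ) (k : ℕ) : pre x (k + 1) = x 0 :: pre (seqShift x) k := by
  simp [pre, List.range_succ_eq_map, Function.comp_def, seqShift]

theorem pre_length (x : ℕ → ℕ) (k : ℕ) : (pre x k).length = k := by simp [pre]

theorem app_single (x : ℕ → ℕ) : app [x 0] (seqShift x) = x := by
  funext n; cases n <;> rfl

theorem pre_add (x : ℕ → ℕ) (i j : ℕ) : pre x (i + j) = pre x i ++ pre (fun n => x (i + n)) j := by
  simp [pre, List.range_add, Function.comp_def]

theorem app_pre (x : ℕ → ℕ) (i : ℕ) : app (pre x i) (fun n => x (i + n)) = x := by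
  induction i generalizing x with
  | zero => simp [pre, app]
  | succ i ih =>
    rw [pre_succ']
    have := ih (seqShift x)
    have e : (fun n => seqShift x (i + n)) = (fun n => x (i + 1 + n)) := by
      funext n; simp only [seqShift]; congr 1; omega
    rw [e] at this
    simp only [app, this]
    funext n; cases n <;> rfl

/-- ultrafilter trees -/
def IsTr (τ : List ℕ → Set ℕ) : Prop := ∀ t, τ t ∈ hyperfilter ℕ

/-- branches -/
def brs (τ : List ℕ → Set ℕ) : Set (ℕ → ℕ) := {x | ∀ k, x k ∈ τ (pre x k)}

theorem exists_br {τ : List ℕ → Set ℕ} (h : IsTr τ) : (brs τ).Nonempty := by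
  have : ∀ t, ∃ a, a ∈ τ t := fun t => Ultrafilter.nonempty_of_mem (h t)
  choose a ha using this
  let L : ℕ → List ℕ := fun n => Nat.rec [] (fun _ l => l ++ [a l]) n
  have hL : ∀ k, pre (fun k => a (L k)) k = L k := by
    intro k; induction k with
    | zero => rfl
    | succ k ih => rw [pre_succ, ih]
  refine ⟨fun k => a (L k), fun k => ?_⟩
  rw [hL]; exact ha _

/-- large sets -/
def Lg (X : Set (ℕ → ℕ)) : Prop := ∃ τ, IsTr τ ∧ brs τ ⊆ X

theorem Lg.mono {X Y : Set (ℕ → ℕ)} (h : Lg X) (hXY : X ⊆ Y) : Lg Y := by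
  obtain ⟨τ, h1, h2⟩ := h; exact ⟨τ, h1, h2.trans hXY⟩

/-- completely decided sets -/
def CH (X : Set (ℕ → ℕ)) : Prop :=
  ∀ t, Lg {x | app t x ∈ X} ∨ Lg {x | app t x ∉ X}

theorem lg_glue {X : Set (ℕ → ℕ)} {t : List ℕ}
    (h : {a | Lg {x | app (t ++ [a]) x ∈ X}} ∈ hyperfilter ℕ) : Lg {x | app t x ∈ X} := by
  classical
  have : ∀ a, ∃ τ, IsTr τ ∧ ((Lg {x | app (t ++ [a]) x ∈ X}) →
      brs τ ⊆ {x | app (t ++ [a]) x ∈ X}) := by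
    intro a
    by_cases ha : Lg {x | app (t ++ [a]) x ∈ X}
    · obtain ⟨τ, h1, h2⟩ := ha
      exact ⟨τ, h1, fun _ => h2⟩
    · exact ⟨fun _ => univ, fun _ => univ_mem, fun h => absurd h ha⟩
  choose τ h1 h2 using this
  refine ⟨fun s => match s with | [] => {a | Lg {x | app (t ++ [a]) x ∈ X}} | a :: s => τ a s,
    ?_, ?_⟩
  · rintro (_ | ⟨a, s⟩)
    · exact h
    · exact h1 a s
  · intro x hx
    have h0 : Lg {y | app (t ++ [x 0]) y ∈ X} := hx 0
    have hb : seqShift x ∈ brs (τ (x 0)) := by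
      intro k
      have := hx (k + 1)
      rw [pre_succ'] at this
      exact this
    have := h2 _ h0 hb
    rw [mem_ofPred_eq, app_append, app_single] at this
    exact this

theorem lg_union {X : ℕ → Set (ℕ → ℕ)} (h : ∀ i, CH (X i)) :
    Lg (⋃ i, X i) ∨ Lg (⋃ i, X i)ᶜ := by
  classical
  set Y := ⋃ i, X i with hY
  by_cases h0 : Lg Y
  · exact Or.inl h0
  right
  have hP : ∀ i t, ∃ τ, IsTr τ ∧ (¬ Lg {x | app t x ∈ Y} → brs τ ⊆ {x | app t x ∉ X i}) := by
    intro i t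
    rcases h i t with h1 | ⟨τ, h1, h2⟩
    · refine ⟨fun _ => univ, fun _ => univ_mem, fun hn => absurd (h1.mono ?_) hn⟩
      intro x hx; exact mem_iUnion.2 ⟨i, hx⟩
    · exact ⟨τ, h1, fun _ => h2⟩
  choose τ h1 h2 using hP
  refine ⟨fun t => {a | ¬ Lg {x | app t x ∈ Y} → ¬ Lg {x | app (t ++ [a]) x ∈ Y}} ∩
    ⋂ i ∈ Finset.range (t.length + 1), τ i (t.take i) (t.drop i), ?_, ?_⟩
  · intro t
    refine inter_mem ?_ ?_
    · by_cases hn : Lg {x | app t x ∈ Y}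
      · simp [hn]
      · have : {a | Lg {x | app (t ++ [a]) x ∈ Y}} ∉ hyperfilter ℕ := fun hc => hn (lg_glue hc)
        rw [← Ultrafilter.compl_mem_iff_notMem] at this
        exact mem_of_superset this fun a ha _ => ha
    · rw [biInter_finset_mem]
      intro i _; exact h1 _ _ _
  · intro x hx
    have hrej : ∀ k, ¬ Lg {y | app (pre x k) y ∈ Y} := by
      intro k; induction k with
      | zero => exact h0
      | succ k ih =>
        rw [pre_succ]; exact (hx k).1 ih
    intro hxY
    obtain ⟨i, hi⟩ := mem_iUnion.1 hxY
    have hb : (fun n => x (i + n)) ∈ brs (τ i (pre x i)) := by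
      intro k
      have := mem_iInter₂.1 (hx (i + k)).2 i (by simp [pre_length])
      rw [pre_add, List.take_left' (pre_length _ _), List.drop_left' (pre_length _ _)] at this
      exact this
    have := h2 i _ (hrej i) hb
    rw [mem_ofPred_eq, app_pre] at this
    exact this hi

theorem CH.app {X : Set (ℕ → ℕ)} (h : CH X) (t : List ℕ) : CH {x | TLO.app t x ∈ X} := by
  intro u
  simp only [mem_ofPred_eq, ← app_append]
  exact h _

theorem CH.compl {X : Set (ℕ → ℕ)} (h : CH X) : CH Xᶜ := by
  intro t
  rcases h t with h | h
  · right; simpa using h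
  · left; exact h

theorem CH.iUnion {X : ℕ → Set (ℕ → ℕ)} (h : ∀ i, CH (X i)) : CH (⋃ i, X i) := by
  intro t
  have := lg_union fun i => (h i).app t
  have e : (⋃ i, {x | TLO.app t x ∈ X i}) = {x | TLO.app t x ∈ ⋃ i, X i} := by ext x; simp
  rw [e] at this
  exact this

theorem CH.const (p : Prop) : CH {_x | p} := by
  intro t
  by_cases hp : p
  · exact Or.inl ⟨fun _ => univ, fun _ => univ_mem, fun _ _ => hp⟩
  · exact Or.inr ⟨fun _ => univ, fun _ => univ_mem, fun _ _ => hp⟩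

theorem CH.coord (k : ℕ) (E : Set ℕ) : CH {x | x k ∈ E} := by
  intro t
  have key : (∃ j, ∀ x, TLO.app t x k = x j) ∨ ∃ a, ∀ x, TLO.app t x k = a := by
    induction t generalizing k with
    | nil => exact Or.inl ⟨k, fun _ => rfl⟩
    | cons a t ih =>
      cases k with
      | zero => exact Or.inr ⟨a, fun _ => rfl⟩
      | succ k => exact ih k
  rcases key with ⟨j, hj⟩ | ⟨a, ha⟩
  · simp only [mem_ofPred_eq, hj]
    rcases Ultrafilter.mem_or_compl_mem (hyperfilter ℕ) E with hE | hE
    · exact Or.inl ⟨fun _ => E, fun _ => hE, fun x hx => hx j⟩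
    · exact Or.inr ⟨fun _ => Eᶜ, fun _ => hE, fun x hx => hx j⟩
  · simp only [mem_ofPred_eq, ha]
    exact CH.const (a ∈ E) []

theorem ch_of_meas {X : Set (ℕ → ℕ)} (h : MeasurableSet X) : CH X := by
  let M : MeasurableSpace (ℕ → ℕ) :=
    { MeasurableSet' := CH
      measurableSet_empty := CH.const False
      measurableSet_compl := fun _ h => h.compl
      measurableSet_iUnion := fun _ h => CH.iUnion h }
  have hle : (MeasurableSpace.pi : MeasurableSpace (ℕ → ℕ)) ≤ M := by
    refine iSup_le fun k => ?_
    rintro _ ⟨E, -, rfl⟩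
    exact CH.coord k E
  exact hle X h

/-- the space of increasing sequences -/
abbrev Inc := {x : ℕ → ℕ // StrictMono x}

/-- the shift -/
def incS (x : Inc) : Inc := ⟨seqShift x.1, fun i j h => x.2 (by omega)⟩

theorem incS_meas : Measurable incS := by
  refine Measurable.subtype_mk ?_
  rw [measurable_pi_iff]
  intro k
  exact (measurable_pi_apply (k + 1)).comp measurable_subtype_coe

theorem no_colour (c : Inc → Fin 3) (hc : Measurable c) : ∃ x, c x = c (incS x) := by
  have hB : ∀ i : Fin 3, ∃ B : Set (ℕ → ℕ), MeasurableSet B ∧ Subtype.val ⁻¹' B = c ⁻¹' {i} :=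
    fun i => hc (measurableSet_singleton i)
  choose B hBm hBc using hB
  have hBmem : ∀ (i : Fin 3) (x : Inc), x.1 ∈ B i ↔ c x = i := by
    intro i x
    have : x ∈ Subtype.val ⁻¹' B i ↔ x ∈ c ⁻¹' {i} := by rw [hBc]
    simpa using this
  have key : ∀ τ, IsTr τ → ∃ x : Inc, x.1 ∈ brs τ ∧ (incS x).1 ∈ brs τ := by
    intro τ hτ
    obtain ⟨x, hx⟩ := exists_br (τ := fun t => τ t ∩ τ t.tail ∩ ⋂ b ∈ t.toFinset, {a | b < a})
      (by
        intro t
        refine inter_mem (inter_mem (hτ _) (hτ _)) ?_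
        rw [biInter_finset_mem]
        intro b _
        refine Nat.hyperfilter_le_atTop (Ioi_mem_atTop b))
    refine ⟨⟨x, strictMono_nat_of_lt_succ fun n => ?_⟩, fun k => (hx k).1.1, fun k => ?_⟩
    · have := mem_iInter₂.1 (hx (n + 1)).2 (x n) (by simp [pre_succ])
      exact this
    · have := (hx (k + 1)).1.2
      rw [pre_succ'] at this
      exact this
  by_cases h : ∃ i, Lg (B i)
  · obtain ⟨i, τ, hτ, hτB⟩ := h
    obtain ⟨x, h1, h2⟩ := key τ hτ
    refine ⟨x, ?_⟩
    rw [(hBmem i x).1 (hτB h1), (hBmem i _).1 (hτB h2)]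
  · push Not at h
    have : ∀ i, Lg (B i)ᶜ := fun i => ((ch_of_meas (hBm i)) []).resolve_left (h i)
    choose τ h1 h2 using this
    obtain ⟨x, hx, -⟩ := key (fun t => ⋂ i, τ i t) (fun t => iInter_mem.2 fun i => h1 i t)
    exact absurd ((hBmem (c x) x).2 rfl) (h2 (c x) fun k => mem_iInter.1 (hx k) _)

theorem good_inc {P : Type*} {ρ : P → P → Prop} (hP : Good incS ρ) {F : Inc → P} (hF : DM F) :
    ∃ x, ρ (F x) (F (incS x)) := by
  by_contra hcon
  push Not at hcon
  obtain ⟨A, hA, hA'⟩ := hP F hF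
  obtain ⟨c, hc, hc'⟩ := colour_of_split incS_meas A hA fun x => hA' x (Eventually.of_forall
    fun k => by rw [Function.iterate_succ_apply']; exact hcon _)
  obtain ⟨x, hx⟩ := no_colour c hc
  exact hc' x hx

end Ramsey
end TLO
namespace TLO
open Set Filter
universe u v
section Words
variable {Q : Type v} (r : Q → Q → Prop)

/-- a segment `[a, b)` of a labeled sequence of ordinal length -/
structure Wd (Q : Type v) : Type (max (u + 1) v) where
  l : Ordinal.{u} → Q
  a : Ordinal.{u}
  b : Ordinal.{u}

/-- labeled embeddability of segments -/
def Emb (s t : Wd.{u} Q) : Prop := ∃ f : Ordinal.{u} → Ordinal.{u},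
  (∀ x y, s.a ≤ x → x < y → y < s.b → f x < f y) ∧
  ∀ x, s.a ≤ x → x < s.b → t.a ≤ f x ∧ f x < t.b ∧ r (s.l x) (t.l (f x))

variable {r}

theorem emb_empty {s t : Wd.{u} Q} (h : s.b ≤ s.a) : Emb r s t :=
  ⟨id, fun _ _ h1 h2 h3 => absurd (h1.trans_lt (h2.trans h3)) h.not_gt,
    fun _ h1 h2 => absurd (h1.trans_lt h2) h.not_gt⟩

theorem emb_trans (ht : Transitive r) {s t w : Wd.{u} Q} (h1 : Emb r s t) (h2 : Emb r t w) :
    Emb r s w := by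
  obtain ⟨f, f1, f2⟩ := h1
  obtain ⟨g, g1, g2⟩ := h2
  refine ⟨fun x => g (f x), fun x y h1 h2 h3 => ?_, fun x h1 h2 => ?_⟩
  · exact g1 _ _ (f2 x h1 (h2.trans h3)).1 (f1 x y h1 h2 h3) (f2 y (h1.trans h2.le) h3).2.1
  · obtain ⟨a1, a2, a3⟩ := f2 x h1 h2
    obtain ⟨b1, b2, b3⟩ := g2 _ a1 a2
    exact ⟨b1, b2, ht a3 b3⟩

theorem emb_sub (hr : Reflexive r) {l : Ordinal.{u} → Q} {a b a' b' : Ordinal.{u}}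
    (h : a' ≤ a) (h' : b ≤ b') : Emb r ⟨l, a, b⟩ ⟨l, a', b'⟩ :=
  ⟨id, fun _ _ _ h _ => h, fun x h1 h2 => ⟨h.trans h1, h2.trans_le h', hr _⟩⟩

theorem emb_mono_right {s : Wd.{u} Q} {l : Ordinal.{u} → Q} {a b a' b' : Ordinal.{u}}
    (h : a' ≤ a) (h' : b ≤ b') (hs : Emb r s ⟨l, a, b⟩) : Emb r s ⟨l, a', b'⟩ := by
  obtain ⟨f, f1, f2⟩ := hs
  refine ⟨f, f1, fun x h1 h2 => ?_⟩
  obtain ⟨a1, a2, a3⟩ := f2 x h1 h2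
  exact ⟨h.trans a1, lt_of_lt_of_le a2 h', a3⟩

theorem emb_glue {l l' : Ordinal.{u} → Q} {a c b a' c' b' : Ordinal.{u}}
    (hac : a' ≤ c') (hcb : c' ≤ b')
    (h1 : Emb r ⟨l, a, c⟩ ⟨l', a', c'⟩) (h2 : Emb r ⟨l, c, b⟩ ⟨l', c', b'⟩) :
    Emb r ⟨l, a, b⟩ ⟨l', a', b'⟩ := by
  classical
  obtain ⟨f, f1, f2⟩ := h1
  obtain ⟨g, g1, g2⟩ := h2
  simp only at f1 f2 g1 g2
  refine ⟨fun x => if x < c then f x else g x, fun x y h1 h2 h3 => ?_, fun x h1 h2 => ?_⟩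
  · simp only at h1 h3
    by_cases hx : x < c
    · by_cases hy : y < c
      · simp only [hx, hy, if_true]; exact f1 x y h1 h2 hy
      · simp only [hx, hy, if_true, if_false]
        exact (f2 x h1 hx).2.1.trans_le (g2 y (not_lt.1 hy) h3).1
    · have hy : ¬ y < c := fun hy => hx (h2.trans hy)
      simp only [hx, hy, if_false]
      exact g1 x y (not_lt.1 hx) h2 h3
  · simp only at h1 h2
    by_cases hx : x < c
    · simp only [hx, if_true]
      obtain ⟨a1, a2, a3⟩ := f2 x h1 hx
      exact ⟨a1, a2.trans_le hcb, a3⟩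
    · simp only [hx, if_false]
      obtain ⟨a1, a2, a3⟩ := g2 x (not_lt.1 hx) h2
      exact ⟨hac.trans a1, a2, a3⟩

variable (r) in
/-- the greedy embedding -/
noncomputable def greedy (s t : Wd.{u} Q) (x : Ordinal.{u}) : Ordinal.{u} :=
  sInf {y | t.a ≤ y ∧ (∀ z, z < x → s.a ≤ z → greedy s t z < y) ∧ r (s.l x) (t.l y)}
termination_by x

theorem emb_cont {s t : Wd.{u} Q} (hlim : ∀ x, s.a ≤ x → x < s.b → x + 1 < s.b)
    (h : ∀ e, e < s.b → Emb r ⟨s.l, s.a, e⟩ t) : Emb r s t := by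
  have key : ∀ x, s.a ≤ x → x < s.b →
      greedy r s t x < t.b ∧ t.a ≤ greedy r s t x ∧
      (∀ z, z < x → s.a ≤ z → greedy r s t z < greedy r s t x) ∧
        r (s.l x) (t.l (greedy r s t x)) := by
    intro x hx hxb
    obtain ⟨g, g1, g2⟩ := h (x + 1) (hlim x hx hxb)
    simp only at g1 g2
    have aux : ∀ z, s.a ≤ z → z < x + 1 →
        greedy r s t z ≤ g z ∧ t.a ≤ greedy r s t z ∧
        (∀ w, w < z → s.a ≤ w → greedy r s t w < greedy r s t z) ∧
          r (s.l z) (t.l (greedy r s t z)) := by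
      intro z
      induction z using WellFoundedLT.induction with
      | ind z ih =>
        intro hz hzx
        obtain ⟨a1, a2, a3⟩ := g2 z hz hzx
        have hm : g z ∈ {y | t.a ≤ y ∧ (∀ w, w < z → s.a ≤ w → greedy r s t w < y) ∧
            r (s.l z) (t.l y)} :=
          ⟨a1, fun w hw hw' => (ih w hw hw' (hw.trans hzx)).1.trans_lt (g1 w z hw' hw hzx), a3⟩
        rw [greedy]
        have hmem := csInf_mem (⟨_, hm⟩ : Set.Nonempty _)
        exact ⟨csInf_le' hm, hmem.1, hmem.2.1, hmem.2.2⟩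
    have hx1 : x < x + 1 := Order.lt_add_one_iff.2 le_rfl
    obtain ⟨b1, b2, b3, b4⟩ := aux x hx hx1
    exact ⟨b1.trans_lt (g2 x hx hx1).2.1, b2, b3, b4⟩
  exact ⟨greedy r s t, fun x y h1 h2 h3 => (key y (h1.trans h2.le) h3).2.2.1 x h2 h1,
    fun x h1 h2 => ⟨(key x h1 h2).2.1, (key x h1 h2).1, (key x h1 h2).2.2.2⟩⟩

variable (r) in
/-- indecomposable segments -/
def Indec (s : Wd.{u} Q) : Prop :=
  s.a < s.b ∧ ∀ c, s.a ≤ c → c < s.b → Emb r s ⟨s.l, c, s.b⟩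

theorem indec_cases {s : Wd.{u} Q} (h : Indec r s) (hs : s.b ≠ s.a + 1) :
    ∀ x, s.a ≤ x → x < s.b → x + 1 < s.b := by
  intro x hx hxb
  by_contra hcon
  have hb : s.b = x + 1 := le_antisymm (not_lt.1 hcon) (Order.add_one_le_of_lt hxb)
  rcases hx.eq_or_lt with rfl | hlt
  · exact hs hb
  · obtain ⟨f, f1, f2⟩ := h.2 x hx hxb
    have h1 := f1 s.a x le_rfl hlt hxb
    have h2 := (f2 s.a le_rfl h.1).1
    have h3 := (f2 x hx hxb).2.1
    simp only [hb] at h2 h3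
    exact absurd (h2.trans_lt h1) (not_lt.2 (Order.lt_add_one_iff.1 h3))

theorem indec_single (hr : Reflexive r) (l : Ordinal.{u} → Q) (a : Ordinal.{u}) :
    Indec r ⟨l, a, a + 1⟩ := by
  refine ⟨Order.lt_add_one_iff.2 le_rfl, fun c h1 h2 => ?_⟩
  have : c = a := le_antisymm (Order.lt_add_one_iff.1 h2) h1
  subst this
  exact emb_sub hr le_rfl le_rfl

variable (r) in
/-- finite concatenations of indecomposable segments -/
inductive Dec (l : Ordinal.{u} → Q) : Ordinal.{u} → Ordinal.{u} → Prop
  | nil (a) : Dec l a a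
  | cons {a c b} : Indec r ⟨l, a, c⟩ → Dec l c b → Dec l a b

theorem Dec.le {l : Ordinal.{u} → Q} {a b : Ordinal.{u}} (h : Dec r l a b) : a ≤ b := by
  induction h with
  | nil => exact le_rfl
  | cons h1 _ ih => exact h1.1.le.trans ih

theorem Dec.snoc {l : Ordinal.{u} → Q} {a c b : Ordinal.{u}} (h : Dec r l a c)
    (h' : Indec r ⟨l, c, b⟩) : Dec r l a b := by
  induction h with
  | nil => exact .cons h' (.nil _)
  | cons h1 _ ih => exact .cons h1 (ih h')

variable (r) in
/-- indecomposable segments whose bounded subsegments are decomposable -/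
def Vp (s : Wd.{u} Q) : Prop :=
  Indec r s ∧ ∀ z e, s.a ≤ z → z ≤ e → e < s.b → Dec r s.l z e

theorem vp_single (hr : Reflexive r) (l : Ordinal.{u} → Q) (a : Ordinal.{u}) :
    Vp r ⟨l, a, a + 1⟩ := by
  refine ⟨indec_single hr l a, fun z e h1 h2 h3 => ?_⟩
  have : z = e := le_antisymm h2 ((Order.lt_add_one_iff.1 h3).trans h1)
  subst this
  exact .nil _

variable (r) in
/-- the type of hereditarily decomposable indecomposables -/
abbrev Wt := {s : Wd.{u} Q // Vp r s}

/-- not a singleton -/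
def Lim (s : Wd.{u} Q) : Prop := s.b ≠ s.a + 1

/-- the relation on pieces -/
def rho : Option (Wt.{u} r) → Option (Wt.{u} r) → Prop
  | none, none => True
  | none, some t => Lim t.1
  | some _, none => False
  | some s, some t => Emb r s.1 t.1

/-- the elements of a piece -/
def elt : Option (Wt.{u} r) → Set (Option (Wt.{u} r))
  | none => {none}
  | some s => {p | (¬ Lim s.1 ∧ p = some s) ∨ (Lim s.1 ∧ (p = none ∨ ∃ z : Wt.{u} r, p = some z ∧
      z.1.l = s.1.l ∧ s.1.a ≤ z.1.a ∧ z.1.b < s.1.b))}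

theorem key_limit (ht : Transitive r) {s t : Wd.{u} Q} (hs : Vp r s) (hlim : Lim s)
    (hti : Indec r t)
    (h : ∀ z : Wt.{u} r, z.1.l = s.l → s.a ≤ z.1.a → z.1.b < s.b →
      ∃ e, e < t.b ∧ Emb r z.1 ⟨t.l, t.a, e⟩) : Emb r s t := by
  have claim : ∀ z e, Dec r s.l z e → s.a ≤ z → e < s.b →
      ∃ e', t.a ≤ e' ∧ e' < t.b ∧ Emb r ⟨s.l, z, e⟩ ⟨t.l, t.a, e'⟩ := by
    intro z e hd
    induction hd with
    | nil a => intro _ _; exact ⟨t.a, le_rfl, hti.1, emb_empty le_rfl⟩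
    | @cons a c b h1 h2 ih =>
      intro ha hb
      have hac : a < c := h1.1
      obtain ⟨e2, he2, he2', hE2⟩ := ih (ha.trans hac.le) hb
      obtain ⟨e1, he1, hE1⟩ := h ⟨⟨s.l, a, c⟩, h1, fun z e k1 k2 k3 =>
        hs.2 z e (ha.trans k1) k2 (k3.trans (h2.le.trans_lt hb))⟩ rfl ha (h2.le.trans_lt hb)
      have hE1' : Emb r ⟨s.l, a, c⟩ ⟨t.l, t.a, max t.a e1⟩ :=
        emb_mono_right le_rfl (le_max_right _ _) hE1
      have hm1 : t.a ≤ max t.a e1 := le_max_left _ _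
      have hm2 : max t.a e1 < t.b := max_lt hti.1 he1
      obtain ⟨g, g1, g2⟩ := hti.2 _ hm1 hm2
      simp only at g1 g2
      obtain ⟨k1, k2, -⟩ := g2 e2 he2 he2'
      refine ⟨g e2, hm1.trans k1, k2, emb_glue hm1 k1 hE1' (emb_trans ht hE2 ?_)⟩
      refine ⟨g, fun x y h1 h2 h3 => g1 x y h1 h2 (lt_trans h3 he2'), fun x h1 h2 => ?_⟩
      obtain ⟨a1, -, a3⟩ := g2 x h1 (lt_trans h2 he2')
      exact ⟨a1, g1 x e2 h1 h2 he2', a3⟩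
  refine emb_cont (indec_cases hs.1 hlim) fun e he => ?_
  rcases le_or_gt e s.a with hle | hlt
  · exact emb_empty hle
  · obtain ⟨e', -, h2, h3⟩ := claim s.a e (hs.2 _ _ le_rfl hlt.le he) le_rfl he
    exact emb_mono_right le_rfl h2.le h3

theorem rho_step (hr : Reflexive r) (ht : Transitive r) (x y : Option (Wt.{u} r))
    (h : ¬ rho x y) : ∃ x' ∈ elt x, ∀ y' ∈ elt y, ¬ rho x' y' := by
  rcases x with _ | s
  · rcases y with _ | t
    · exact absurd trivial h
    · have h' : ¬ Lim t.1 := h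
      refine ⟨none, rfl, ?_⟩
      rintro y' (⟨-, rfl⟩ | ⟨h2, -⟩)
      · exact h
      · exact absurd h2 h'
  · rcases y with _ | t
    · by_cases hs : Lim s.1
      · refine ⟨some ⟨_, vp_single hr s.1.l s.1.a⟩, Or.inr ⟨hs, Or.inr ⟨_, rfl, rfl, le_rfl,
          indec_cases s.2.1 hs _ le_rfl s.2.1.1⟩⟩, ?_⟩
        rintro y' rfl
        exact id
      · refine ⟨some s, Or.inl ⟨hs, rfl⟩, ?_⟩
        rintro y' rfl
        exact id
    · have h' : ¬ Emb r s.1 t.1 := h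
      by_cases hs : Lim s.1
      · by_cases hlt : Lim t.1
        · by_contra hcon
          push Not at hcon
          refine h' (key_limit ht s.2 hs t.2.1 fun z h1 h2 h3 => ?_)
          obtain ⟨y', hy, hz⟩ := hcon (some z) (Or.inr ⟨hs, Or.inr ⟨z, rfl, h1, h2, h3⟩⟩)
          rcases hy with ⟨h4, -⟩ | ⟨-, rfl | ⟨w, rfl, h5, h6, h7⟩⟩
          · exact absurd hlt h4
          · exact hz.elim
          · refine ⟨w.1.b, h7, ?_⟩
            have hz' : Emb r z.1 w.1 := hz
            have : w.1 = ⟨t.1.l, w.1.a, w.1.b⟩ := by rw [← h5]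
            rw [this] at hz'
            exact emb_mono_right h6 le_rfl hz'
        · refine ⟨none, Or.inr ⟨hs, Or.inl rfl⟩, ?_⟩
          rintro y' (⟨-, rfl⟩ | ⟨h2, -⟩)
          · exact hlt
          · exact absurd h2 hlt
      · refine ⟨some s, Or.inl ⟨hs, rfl⟩, ?_⟩
        rintro y' (⟨-, rfl⟩ | ⟨-, rfl | ⟨w, rfl, h5, h6, h7⟩⟩)
        · exact h'
        · exact id
        · intro hz
          have hz' : Emb r s.1 w.1 := hz
          have : w.1 = ⟨t.1.l, w.1.a, w.1.b⟩ := by rw [← h5]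
          rw [this] at hz'
          exact h' (emb_mono_right h6 h7.le hz')

theorem good_rho (hr : Reflexive r) (ht : Transitive r) [Nonempty Q] {V : Type*}
    [MeasurableSpace V] {S : V → V} (hS : Measurable S) (hQ : Good S r) :
    Good S (rho.{u} (r := r)) := by
  refine good_descent hS elt (fun p => match p with | none => True | some s => ¬ Lim s.1)
    (fun p => match p with | none => none | some s => some (s.1.l s.1.a))
    (fun p => match p with | none => (0 : Ordinal.{u}) | some s => s.1.b)
    (rho_step hr ht) ?_ ?_ ?_ (good_opt hQ)
  · rintro (_ | s) hl x' hx'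
    · exact hx'
    · rcases hx' with ⟨-, h⟩ | ⟨h, -⟩
      · exact h
      · exact absurd h hl
  · rintro (_ | s) hl x' hx'
    · exact absurd trivial hl
    · rcases hx' with ⟨h, -⟩ | ⟨-, rfl | ⟨z, rfl, -, -, h⟩⟩
      · exact absurd h hl
      · exact lt_of_le_of_lt zero_le s.2.1.1
      · exact h
  · rintro (_ | s) (_ | t) h1 h2 h3
    · exact absurd trivial h3
    · exact id
    · exact id
    · intro h4
      have h4' : r (s.1.l s.1.a) (t.1.l t.1.a) := h4
      have hb : s.1.b = s.1.a + 1 := not_not.1 h1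
      have hx : ∀ x, s.1.a ≤ x → x < s.1.b → x = s.1.a := fun x k1 k2 =>
        le_antisymm (Order.lt_add_one_iff.1 (hb ▸ k2)) k1
      refine h3 ⟨fun _ => t.1.a, fun x y k1 k2 k3 => ?_, fun x k1 k2 => ?_⟩
      · have e1 := hx x k1 (k2.trans k3)
        have e2 := hx y (k1.trans k2.le) k3
        rw [e1, e2] at k2
        exact absurd k2 (lt_irrefl _)
      · rw [hx x k1 k2]
        exact ⟨le_rfl, t.2.1.1, h4'⟩

variable (r) in
/-- decompositions recorded as lists -/
inductive DecL (l : Ordinal.{u} → Q) : Ordinal.{u} → Ordinal.{u} → List (Option (Wt.{u} r)) → Prop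
  | nil (a) : DecL l a a []
  | cons {a c b L} (h : Vp r ⟨l, a, c⟩) : DecL l c b L → DecL l a b (some ⟨⟨l, a, c⟩, h⟩ :: L)

theorem DecL.le {l : Ordinal.{u} → Q} {a b : Ordinal.{u}} {L} (h : DecL r l a b L) : a ≤ b := by
  induction h with
  | nil => exact le_rfl
  | cons h1 _ ih => exact h1.1.1.le.trans ih

theorem exists_decL {l : Ordinal.{u} → Q} {a b : Ordinal.{u}} (h : Dec r l a b)
    (hb : ∀ z e, z ≤ e → e < b → Dec r l z e) : ∃ L, DecL r l a b L := by
  induction h with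
  | nil a => exact ⟨[], .nil a⟩
  | cons h1 h2 ih =>
    obtain ⟨L, hL⟩ := ih hb
    exact ⟨_, .cons ⟨h1, fun z e _ k2 k3 => hb z e k2 (lt_of_lt_of_le k3 h2.le)⟩ hL⟩

theorem emb_of_list {L L' : List (Option (Wt.{u} r))}
    (h : List.SublistForall₂ rho L L') : ∀ {l l' : Ordinal.{u} → Q} {a b a' b' : Ordinal.{u}},
    DecL r l a b L → DecL r l' a' b' L' → Emb r ⟨l, a, b⟩ ⟨l', a', b'⟩ := by
  induction h with
  | nil =>
    intro l l' a b a' b' h _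
    cases h
    exact emb_empty le_rfl
  | cons hρ _ ih =>
    intro l l' a b a' b' h h'
    cases h with
    | cons k1 k2 =>
      cases h' with
      | cons k1' k2' => exact emb_glue k1'.1.1.le k2'.le hρ (ih k2 k2')
  | cons_right _ ih =>
    intro l l' a b a' b' h h'
    cases h' with
    | cons k1' k2' => exact emb_mono_right k1'.1.1.le le_rfl (ih h k2')

theorem dm_coord (k : ℕ) : DM (fun x : Inc => x.1 k) := by
  refine ⟨to_countable _, fun p => ?_⟩
  exact ((measurable_pi_apply k).comp measurable_subtype_coe) (measurableSet_singleton p)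

theorem dec_all (hr : Reflexive r) (ht : Transitive r) [Nonempty Q] (hQ : Good incS r)
    (l : Ordinal.{u} → Q) : ∀ b a : Ordinal.{u}, a ≤ b → Dec r l a b := by
  intro b
  induction b using WellFoundedLT.induction with
  | ind b ih =>
  intro a hab
  rcases hab.eq_or_lt with rfl | hab
  · exact .nil _
  by_cases hsucc : ∃ x, a ≤ x ∧ b = x + 1
  · obtain ⟨x, hx, rfl⟩ := hsucc
    exact (ih x (Order.lt_add_one_iff.2 le_rfl) a hx).snoc (indec_single hr l x)
  have hlim : ∀ x, a ≤ x → x < b → x + 1 < b := by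
    intro x hx hxb
    by_contra hcon
    exact hsucc ⟨x, hx, le_antisymm (not_lt.1 hcon) (Order.add_one_le_of_lt hxb)⟩
  by_cases hind : ∃ c, a ≤ c ∧ c < b ∧ Indec r ⟨l, c, b⟩
  · obtain ⟨c, h1, h2, h3⟩ := hind
    exact (ih c h2 a h1).snoc h3
  exfalso
  have hstep : ∀ c : {c // a ≤ c ∧ c < b}, ∃ d : {c // a ≤ c ∧ c < b}, c.1 ≤ d.1 ∧
      ¬ Emb r ⟨l, c.1, b⟩ ⟨l, d.1, b⟩ := by
    rintro ⟨c, h1, h2⟩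
    by_contra hcon
    push Not at hcon
    exact hind ⟨c, h1, h2, h2, fun d k1 k2 => hcon ⟨d, le_trans h1 k1, k2⟩ k1⟩
  choose d hd1 hd2 using hstep
  let c : ℕ → {c // a ≤ c ∧ c < b} := fun n => Nat.rec ⟨a, le_rfl, hab⟩ (fun _ c => d c) n
  have hcs : ∀ n, c (n + 1) = d (c n) := fun n => rfl
  have hmono : Monotone fun n => (c n).1 := monotone_nat_of_le_succ fun n => by
    rw [hcs]; exact hd1 _
  have hc : ∀ i j, i < j → ¬ Emb r ⟨l, (c i).1, b⟩ ⟨l, (c j).1, b⟩ := by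
    intro i j hij h
    refine hd2 (c i) (emb_mono_right ?_ le_rfl h)
    rw [← hcs]
    exact hmono (Nat.succ_le_of_lt hij)
  have he : ∀ i j, ∃ e L, e < b ∧ DecL r l (c i).1 e L ∧
      (i < j → ¬ Emb r ⟨l, (c i).1, e⟩ ⟨l, (c j).1, b⟩) := by
    intro i j
    by_cases hij : i < j
    · have : ∃ e, e < b ∧ ¬ Emb r ⟨l, (c i).1, e⟩ ⟨l, (c j).1, b⟩ := by
        by_contra hcon
        push Not at hcon
        exact hc i j hij (emb_cont (fun x h1 h2 => hlim x (le_trans (c i).2.1 h1) h2) hcon)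
      obtain ⟨e, he, hE⟩ := this
      have hle : (c i).1 ≤ e := by
        by_contra hlt
        exact hE (emb_empty (not_le.1 hlt).le)
      obtain ⟨L, hL⟩ := exists_decL (ih e he _ hle) fun z e' k1 k2 => ih e' (k2.trans he) z k1
      exact ⟨e, L, he, hL, fun _ => hE⟩
    · exact ⟨(c i).1, [], (c i).2.2, .nil _, fun h => absurd h hij⟩
  choose e L he hL hE using he
  obtain ⟨x, hx⟩ := good_inc (good_list incS_meas (good_rho hr ht incS_meas hQ))
    (((dm_coord 0).prod (dm_coord 1)).comp fun p => L p.1 p.2)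
  have hx01 : x.1 0 < x.1 1 := x.2 (by omega)
  refine hE _ _ hx01 ?_
  refine emb_mono_right le_rfl (he (x.1 1) (x.1 2)).le (emb_of_list hx (hL _ _) (hL _ _))

end Words

theorem main_aux {Q : Type v} (r : Q → Q → Prop) (hr : Reflexive r) (ht : Transitive r)
    (hQ : IsThin r) [Nonempty Q] {R : Type*} [Countable R] (o : R → Ordinal.{u})
    (l : R → Ordinal.{u} → Q) :
    IsThin (fun x y : R => Emb r ⟨l x, 0, o x⟩ ⟨l y, 0, o y⟩) := by
  letI : MeasurableSpace R := ⊤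
  set ρ : R → R → Prop := fun x y : R => Emb r ⟨l x, 0, o x⟩ ⟨l y, 0, o y⟩ with hρ
  have hdec : ∀ x, ∃ L, DecL r (l x) 0 (o x) L := fun x =>
    exists_decL (dec_all hr ht (good_of_thin incS_meas hQ) _ _ _ zero_le)
      fun z e k _ => dec_all hr ht (good_of_thin incS_meas hQ) _ _ _ k
  choose L hL using hdec
  let S : vecSet ρ → vecSet ρ := fun X => ⟨seqShift X.1, fun k => X.2 (k + 1)⟩
  have hS : Measurable S := by
    refine Measurable.subtype_mk ?_
    rw [measurable_pi_iff]
    intro k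
    exact (measurable_pi_apply (k + 1)).comp measurable_subtype_coe
  have hF : DM (fun X : vecSet ρ => X.1 0) := by
    refine ⟨to_countable _, fun p => ?_⟩
    have h1 : Measurable (fun X : vecSet ρ => X.1 0) :=
      (measurable_pi_apply 0).comp measurable_subtype_coe
    exact h1 (t := {p}) trivial
  obtain ⟨A, hA, hA'⟩ := good_list hS (good_rho hr ht hS (good_of_thin hS hQ)) _ (hF.comp L)
  obtain ⟨c, hc, hc'⟩ := colour_of_split hS A hA fun X => hA' X (Eventually.of_forall fun k h => by
    rw [Function.iterate_succ_apply'] at h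
    exact (S^[k] X).2 0 (emb_of_list h (hL _) (hL _)))
  exact ⟨c, hc, fun X hX _ => hc' ⟨X, hX⟩⟩

end TLO

/-- If `Q` is a countable thin quasi-order and `κ` is any ordinal, then every countable
collection of `Q`-labeled ordinals below `κ`, quasi-ordered by labeled embeddability, is thin. -/
theorem thin_labeled_ordinals {Q : Type*} [Countable Q]
    (r : Q → Q → Prop) (hr : Reflexive r) (ht : Transitive r)
    (hQ : IsThin r) (κ : Ordinal)
    (R : Set (Σ α : {α : Ordinal // α < κ}, {β : Ordinal // β < α.1} → Q))
    (hR : R.Countable) :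
    IsThin (fun L₁ L₂ : R =>
      ∃ f : {β : Ordinal // β < L₁.1.1.1} → {β : Ordinal // β < L₂.1.1.1},
        StrictMono f ∧ ∀ β, r (L₁.1.2 β) (L₂.1.2 (f β))) := by
  classical
  have := hR.to_subtype
  cases isEmpty_or_nonempty Q with
  | inl hE =>
    refine ⟨fun _ => 0, measurable_const, fun X hX => ?_⟩
    have hno : ∀ L : R, ∀ β : {β : Ordinal // β < L.1.1.1}, False := fun L β =>
      hE.false (L.1.2 β)
    exact absurd ⟨fun β => (hno _ β).elim, fun β => (hno _ β).elim, fun β => (hno _ β).elim⟩ (hX 0)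
  | inr hne =>
    obtain ⟨q0⟩ := id hne
    have key := TLO.main_aux r hr ht hQ (R := R) (fun L => L.1.1.1)
      (fun L β => if h : β < L.1.1.1 then L.1.2 ⟨β, h⟩ else q0)
    convert key using 3 with L₁ L₂
    constructor
    · rintro ⟨f, f1, f2⟩
      refine ⟨fun x => if h : x < L₁.1.1.1 then (f ⟨x, h⟩).1 else 0, fun x y h1 h2 h3 => ?_,
        fun x h1 h2 => ?_⟩
      · have h3' : y < L₁.1.1.1 := h3
        have hx : x < L₁.1.1.1 := h2.trans h3'
        simp only [hx, h3', dif_pos]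
        exact f1 (show (⟨x, hx⟩ : {β : Ordinal // β < L₁.1.1.1}) < ⟨y, h3'⟩ from h2)
      · have h2' : x < L₁.1.1.1 := h2
        have h4 := (f ⟨x, h2'⟩).2
        have h5 := f2 ⟨x, h2'⟩
        simp only [h2', dif_pos, h4]
        exact ⟨zero_le, trivial, h5⟩
    · rintro ⟨f, f1, f2⟩
      refine ⟨fun x => ⟨f x.1, (f2 x.1 zero_le x.2).2.1⟩, fun x y h => f1 _ _ zero_le h y.2,
        fun x => ?_⟩
      have h1 := (f2 x.1 zero_le x.2).2.2
      have h2 := (f2 x.1 zero_le x.2).2.1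
      have h3 := x.2
      simp only at h1 h2
      simp only [h2, h3, dif_pos] at h1
      exact h1
end
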